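/- arXiv:1105.2529 — 7 statements merged into one kernel-verified Lean document; each statement's English description precedes it below -/
import Mathlib

section
/- Let (X,d) be an A-uniformly perfect complete metric space carrying a D-doubling Borel measure μ. Let Y ⊆ X be a nonempty closed subset and Ω = X ∖ Y. Suppose that (a) there exist M₁ ∈ ℕ, L₁ ≥ 1 and an L₁-bi-Lipschitz embedding f : Y → ℝ^{M₁}; and (b) there exist a Christ–Whitney decomposition M of Ω with constants δ, a₀ ∈ (0,1), C₁ > 0, a number ε ∈ (0,1), and M₂ ∈ ℕ, L₂ ≥ 1 such that for every Q ∈ M the set Q** admits an L₂-bi-Lipschitz embedding into ℝ^{M₂}. Then there exist n ∈ ℕ and L ≥ 1, depending only on A, D, δ, a₀, C₁, ε, M₁, M₂, L₁, L₂, and an L-bi-Lipschitz embedding F : X → ℝⁿ. -/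
/-- The distance between two sets: `inf {d(x,y) : x ∈ s, y ∈ t}`. -/
noncomputable def setDist {X : Type*} [MetricSpace X] (s t : Set X) : ℝ :=
  sInf (Set.image2 dist s t)

/-- `(X,d)` is `A`-uniformly perfect: for every `x` and `0 < r < diam X` there is `y`
with `A⁻¹ r ≤ d(x,y) ≤ r`. -/
def UniformlyPerfect (X : Type*) [MetricSpace X] (A : ℝ) : Prop :=
  ∀ (x : X) (r : ℝ), 0 < r → ENNReal.ofReal r < EMetric.diam (Set.univ : Set X) →
    ∃ y : X, A⁻¹ * r ≤ dist x y ∧ dist x y ≤ r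

/-- `μ` is `D`-doubling: balls have finite positive measure and
`μ(B(x,2r)) ≤ D μ(B(x,r))`. -/
def IsDoublingMeasure {X : Type*} [MetricSpace X] [MeasurableSpace X]
    (μ : MeasureTheory.Measure X) (D : ℝ) : Prop :=
  (∀ (x : X) (r : ℝ), 0 < r → 0 < μ (Metric.ball x r) ∧ μ (Metric.ball x r) < ⊤) ∧
  ∀ (x : X) (r : ℝ), 0 < r →
    μ (Metric.ball x (2 * r)) ≤ ENNReal.ofReal D * μ (Metric.ball x r)

/-- `f` is `L`-bi-Lipschitz on `s`. -/
def BiLipschitzOn {X E : Type*} [MetricSpace X] [MetricSpace E]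
    (f : X → E) (s : Set X) (L : ℝ) : Prop :=
  ∀ x ∈ s, ∀ y ∈ s,
    L⁻¹ * dist x y ≤ dist (f x) (f y) ∧ dist (f x) (f y) ≤ L * dist x y

/-- A Christ–Whitney decomposition of `Ω = Yᶜ` with constants `δ, a₀ ∈ (0,1)`, `C₁ > 0`:
a countable family of pairwise disjoint open subsets of `Ω` covering `Ω` up to `μ`-measure
zero, with `diam Q ≤ dist(Q,Y) ≤ (4 C₁ A / δ) diam Q`, each cube being a
`(C₁, a₀)`-quasiball. -/
structure ChristWhitney {X : Type*} [MetricSpace X] [MeasurableSpace X]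
    (μ : MeasureTheory.Measure X) (Y : Set X) (A δ a₀ C₁ : ℝ)
    (M : Set (Set X)) : Prop where
  countable : M.Countable
  pairwiseDisjoint : M.PairwiseDisjoint id
  isOpen : ∀ Q ∈ M, IsOpen Q
  subset_compl : ∀ Q ∈ M, Q ⊆ Yᶜ
  almostCover : μ (Yᶜ \ ⋃ Q ∈ M, Q) = 0
  diam_le_dist : ∀ Q ∈ M, Metric.diam Q ≤ setDist Q Y
  dist_le_diam : ∀ Q ∈ M, setDist Q Y ≤ (4 * C₁ * A / δ) * Metric.diam Q
  quasiball : ∀ Q ∈ M, ∃ x ∈ Yᶜ, ∃ k : ℤ,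
    Metric.ball x (a₀ * δ ^ k) ⊆ Q ∧ Q ⊆ Metric.ball x (C₁ * δ ^ k)

/-- `star(Q)`: cubes `R ∈ M` with `dist(Q,R) < ε min(diam Q, diam R)`. -/
def starQ {X : Type*} [MetricSpace X] (ε : ℝ) (M : Set (Set X)) (Q : Set X) :
    Set (Set X) :=
  {R | R ∈ M ∧ setDist Q R < ε * min (Metric.diam Q) (Metric.diam R)}

/-- `star²(Q)`: cubes `S ∈ M` with `dist(S,R) < ε min(diam S, diam R)` for some
`R ∈ star(Q)`. -/
def star2Q {X : Type*} [MetricSpace X] (ε : ℝ) (M : Set (Set X)) (Q : Set X) :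
    Set (Set X) :=
  {S | S ∈ M ∧ ∃ R ∈ starQ ε M Q,
    setDist S R < ε * min (Metric.diam S) (Metric.diam R)}

/-- `Q* = ⋃ {R : R ∈ star(Q)}`. -/
def dstarQ {X : Type*} [MetricSpace X] (ε : ℝ) (M : Set (Set X)) (Q : Set X) :
    Set X := ⋃ R ∈ starQ ε M Q, R

/-- `Q** = ⋃ {S : S ∈ star²(Q)}`. -/
def dstar2Q {X : Type*} [MetricSpace X] (ε : ℝ) (M : Set (Set X)) (Q : Set X) :
    Set X := ⋃ S ∈ star2Q ε M Q, S

/-- The Whitney distance `d_W(Q,R) = dist(Q,R) / min(diam Q, diam R)`. -/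
noncomputable def whitneyDist {X : Type*} [MetricSpace X] (Q R : Set X) : ℝ :=
  setDist Q R / min (Metric.diam Q) (Metric.diam R)

/-- The sum of the coordinate gaps bounds the Euclidean distance. -/
theorem EuclideanSpace.dist_le_sum_abs {ι : Type*} [Fintype ι] (u v : EuclideanSpace ℝ ι) :
    dist u v ≤ ∑ i, |u i - v i| := by
  rw [EuclideanSpace.dist_eq]
  apply Real.sqrt_le_iff.2 ⟨Finset.sum_nonneg fun i _ => abs_nonneg _, ?_⟩
  simp only [Real.dist_eq]
  exact Finset.sum_sq_le_sq_sum_of_nonneg fun i _ => abs_nonneg _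

theorem EuclideanSpace.abs_sub_le_dist {ι : Type*} [Fintype ι] (u v : EuclideanSpace ℝ ι)
    (i : ι) : |u i - v i| ≤ dist u v := by
  rw [EuclideanSpace.dist_eq, ← Real.dist_eq]
  apply Real.le_sqrt_of_sq_le
  exact Finset.single_le_sum (f := fun i => dist (u i) (v i) ^ 2)
    (fun j _ => sq_nonneg _) (Finset.mem_univ i)

theorem exists_le_mul_of_le_sum {m : ℕ} (a : Fin m → ℝ) {t : ℝ} (ht : 0 < t)
    (h : t ≤ ∑ i, a i) : ∃ i, t ≤ (m + 1) * a i := by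
  by_contra! hc
  have h1 : (m + 1) * ∑ i, a i ≤ ∑ _i : Fin m, t := by
    rw [Finset.mul_sum]
    exact Finset.sum_le_sum fun i _ => (hc i).le
  simp only [Finset.sum_const, Finset.card_univ, Fintype.card_fin, nsmul_eq_mul] at h1
  have h2 : ((m : ℝ) + 1) * t ≤ (m + 1) * ∑ i, a i := by gcongr
  linarith

/-- Finitely many Lipschitz functions, one of which detects the distance of any two points,
assemble to a bi-Lipschitz map into Euclidean space. -/
theorem exists_biLipschitzOn_univ_of_coordinates {X ι : Type*} [MetricSpace X] [Fintype ι]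
    (F : ι → X → ℝ) {Λ P : ℝ} (hΛ : 0 ≤ Λ) (hP : 0 ≤ P)
    (hF : ∀ i x y, |F i x - F i y| ≤ Λ * dist x y)
    (hlow : ∀ x y, ∃ i, dist x y ≤ P * |F i x - F i y|) :
    ∃ G : X → EuclideanSpace ℝ (Fin (Fintype.card ι)),
      BiLipschitzOn G Set.univ (Fintype.card ι * Λ + P + 1) := by
  let e := Fintype.equivFin ι
  refine ⟨fun x => WithLp.toLp 2 fun j => F (e.symm j) x, fun x _ y _ => ⟨?_, ?_⟩⟩
  · obtain ⟨i, hi⟩ := hlow x y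
    have h1 := EuclideanSpace.abs_sub_le_dist
      (WithLp.toLp 2 fun j => F (e.symm j) x : EuclideanSpace ℝ (Fin (Fintype.card ι)))
      (WithLp.toLp 2 fun j => F (e.symm j) y) (e i)
    simp only [Equiv.symm_apply_apply] at h1
    refine le_trans ?_ h1
    have hc : 0 ≤ (Fintype.card ι : ℝ) * Λ := by positivity
    rw [inv_mul_le_iff₀ (by positivity)]
    refine hi.trans ?_
    gcongr
    linarith
  · refine (EuclideanSpace.dist_le_sum_abs _ _).trans ?_
    calc _ ≤ ∑ _j : Fin (Fintype.card ι), Λ * dist x y :=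
          Finset.sum_le_sum fun j _ => hF _ _ _
      _ = Fintype.card ι * Λ * dist x y := by simp [mul_assoc]
      _ ≤ _ := by
          gcongr
          linarith

theorem IsDoublingMeasure.measure_ball_two_pow_le {X : Type*} [MetricSpace X]
    [MeasurableSpace X] {μ : MeasureTheory.Measure X} {D : ℝ} (hμ : IsDoublingMeasure μ D)
    (x : X) {r : ℝ} (hr : 0 < r) (m : ℕ) :
    μ (Metric.ball x (2 ^ m * r)) ≤ ENNReal.ofReal D ^ m * μ (Metric.ball x r) := by
  induction m with
  | zero => simp
  | succ m ih =>
    rw [pow_succ', pow_succ', mul_assoc, mul_assoc]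
    exact (hμ.2 x _ (by positivity)).trans (by gcongr)

/-- In a doubling space, separated sets of bounded relative diameter have bounded
cardinality. -/
theorem exists_packing_bound (D ρ : ℝ) (hD : 0 ≤ D) (hρ : 0 ≤ ρ) :
    ∃ B : ℕ, ∀ (X : Type) [MetricSpace X] [MeasurableSpace X] [BorelSpace X]
      (μ : MeasureTheory.Measure X), IsDoublingMeasure μ D →
      ∀ (p : X) (t : ℝ) (T : Finset X), 0 < t → (∀ q ∈ T, dist q p ≤ ρ * t) →
        (∀ q ∈ T, ∀ q' ∈ T, q ≠ q' → t ≤ dist q q') → T.card ≤ B := by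
  obtain ⟨m, hm⟩ := pow_unbounded_of_one_lt (4 * ρ + 2) (one_lt_two (α := ℝ))
  refine ⟨⌈D ^ m⌉₊, fun X _ _ _ μ hμ p t T ht hT hsep => ?_⟩
  set V := μ (Metric.ball p ((ρ + 1) * t)) with hV
  have hVpos := hμ.1 p ((ρ + 1) * t) (by positivity)
  have hle : ∀ q ∈ T, V ≤ ENNReal.ofReal D ^ m * μ (Metric.ball q (t / 2)) := by
    intro q hq
    refine le_trans (MeasureTheory.measure_mono ?_)
      (hμ.measure_ball_two_pow_le q (half_pos ht) m)
    apply Metric.ball_subset_ball'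
    rw [dist_comm]
    nlinarith [hT q hq]
  have hdisj : (T : Set X).PairwiseDisjoint fun q => Metric.ball q (t / 2) := by
    intro q hq q' hq' hne
    apply Metric.ball_disjoint_ball
    linarith [hsep q hq q' hq' hne]
  have hsum : ∑ q ∈ T, μ (Metric.ball q (t / 2)) ≤ V := by
    rw [← MeasureTheory.measure_biUnion_finset hdisj fun q _ => Metric.isOpen_ball.measurableSet]
    refine MeasureTheory.measure_mono (Set.iUnion₂_subset fun q hq => ?_)
    apply Metric.ball_subset_ball'
    nlinarith [hT q hq]
  have hcard : (T.card : ENNReal) * V ≤ ENNReal.ofReal D ^ m * V :=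
    calc (T.card : ENNReal) * V = ∑ _q ∈ T, V := by simp
      _ ≤ ∑ q ∈ T, ENNReal.ofReal D ^ m * μ (Metric.ball q (t / 2)) := Finset.sum_le_sum hle
      _ = ENNReal.ofReal D ^ m * ∑ q ∈ T, μ (Metric.ball q (t / 2)) := by rw [Finset.mul_sum]
      _ ≤ _ := by gcongr
  rw [ENNReal.mul_le_mul_iff_left hVpos.1.ne' hVpos.2.ne, ← ENNReal.ofReal_pow hD,
    ← ENNReal.ofReal_natCast, ENNReal.ofReal_le_ofReal_iff (by positivity)] at hcard
  exact_mod_cast hcard.trans (Nat.le_ceil _)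

/-- Greedy colouring of a symmetric irreflexive relation of bounded degree. -/
theorem exists_coloring_of_bounded_degree {V : Type*} (adj : V → V → Prop)
    (hsymm : ∀ v w, adj v w → adj w v) (hirr : ∀ v, ¬ adj v v) (B : ℕ)
    (hdeg : ∀ (v : V) (T : Finset V), (∀ w ∈ T, adj v w) → T.card ≤ B) :
    ∃ c : V → Fin (B + 1), ∀ v w, adj v w → c v ≠ c w := by
  classical
  let color : V → Fin (B + 1) := IsWellFounded.fix (α := V) WellOrderingRel fun v c =>
    if h : ∃ k, ∀ w (hw : WellOrderingRel w v), adj v w → c w hw ≠ k then h.choose else 0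
  have key : ∀ v w, WellOrderingRel w v → adj v w → color w ≠ color v := by
    intro v
    have hex : ∃ k, ∀ w, WellOrderingRel w v → adj v w → color w ≠ k := by
      by_contra! hc
      choose w _ hadj hcol using hc
      have hinj : Function.Injective w := fun k l hkl => by rw [← hcol k, ← hcol l, hkl]
      have := hdeg v (Finset.univ.image w) (by simpa using hadj)
      rw [Finset.card_image_of_injective _ hinj] at this
      simp at this
    have heq : color v = hex.choose := by
      have h := IsWellFounded.fix_eq (α := V) WellOrderingRel (fun v c =>
        if h : ∃ k : Fin (B + 1), ∀ w (hw : WellOrderingRel w v), adj v w → c w hw ≠ k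
          then h.choose else 0) v
      exact h.trans (dif_pos hex)
    rw [heq]
    exact hex.choose_spec
  refine ⟨color, fun v w hvw => ?_⟩
  rcases trichotomous_of WellOrderingRel v w with h | h | h
  · exact key w v h (hsymm _ _ hvw)
  · subst h
    exact absurd hvw (hirr v)
  · exact (key v w h hvw).symm

/-- A set `U` contains a maximal subset whose distinct points satisfy a symmetric relation. -/
theorem exists_maximal_pairwise_subset {X : Type*} (U : Set X) (rel : X → X → Prop)
    (hsymm : ∀ x y, rel x y → rel y x) :
    ∃ N ⊆ U, N.Pairwise rel ∧ ∀ x ∈ U, x ∈ N ∨ ∃ p ∈ N, ¬ rel x p := by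
  obtain ⟨N, hN⟩ := zorn_subset {N : Set X | N ⊆ U ∧ N.Pairwise rel} (by
    intro c hc hchain
    refine ⟨⋃₀ c, ⟨Set.sUnion_subset fun s hs => (hc hs).1, ?_⟩,
      fun s hs => Set.subset_sUnion_of_mem hs⟩
    exact (Set.pairwise_sUnion hchain.directedOn).2 fun s hs => (hc hs).2)
  refine ⟨N, hN.prop.1, hN.prop.2, fun x hx => ?_⟩
  by_contra! h
  refine h.1 (hN.le_of_ge (y := insert x N) ⟨Set.insert_subset hx hN.prop.1, ?_⟩
    (Set.subset_insert x N) (Set.mem_insert x N))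
  exact hN.prop.2.insert fun p hp _ => ⟨h.2 p hp, hsymm _ _ (h.2 p hp)⟩

/-- Lipschitz functions supported in disjoint balls glue to a Lipschitz function. -/
theorem exists_glue_of_disjoint_balls {X : Type*} [MetricSpace X] (N : Set X) (r : X → ℝ)
    (g : X → X → ℝ) {L : ℝ} (hL : 0 ≤ L)
    (hg : ∀ p x y, |g p x - g p y| ≤ L * dist x y)
    (hsupp : ∀ p x, r p ≤ dist x p → g p x = 0)
    (hdisj : ∀ p ∈ N, ∀ q ∈ N, ∀ x, dist x p < r p → dist x q < r q → p = q) :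
    ∃ G : X → ℝ, (∀ x y, |G x - G y| ≤ 2 * L * dist x y) ∧
      (∀ p ∈ N, ∀ x, dist x p < r p → G x = g p x) ∧
      ∀ x, (∀ p ∈ N, r p ≤ dist x p) → G x = 0 := by
  classical
  let G : X → ℝ := fun x => if h : ∃ p ∈ N, dist x p < r p then g h.choose x else 0
  have hG : ∀ p ∈ N, ∀ x, dist x p < r p → G x = g p x := by
    intro p hp x hx
    have h : ∃ p ∈ N, dist x p < r p := ⟨p, hp, hx⟩
    have : h.choose = p := hdisj _ h.choose_spec.1 _ hp x h.choose_spec.2 hx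
    simp only [G, dif_pos h, this]
  have hG0 : ∀ x, (∀ p ∈ N, r p ≤ dist x p) → G x = 0 := by
    intro x hx
    have h : ¬ ∃ p ∈ N, dist x p < r p := by
      rintro ⟨p, hp, hlt⟩
      exact absurd (hx p hp) (not_le.2 hlt)
    simp only [G, dif_neg h]
  have hone : ∀ p ∈ N, ∀ x y, dist x p < r p → |g p x - G y| ≤ 2 * L * dist x y := by
    intro p hp x y hx
    have hLd : 0 ≤ L * dist x y := by positivity
    by_cases hy : ∃ q ∈ N, dist y q < r q
    · obtain ⟨q, hq, hyq⟩ := hy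
      rw [hG q hq y hyq]
      by_cases hpq : p = q
      · subst hpq
        linarith [hg p x y]
      · have h1 : g p y = 0 := hsupp p y (not_lt.1 fun h => hpq (hdisj p hp q hq y h hyq))
        have h2 : g q x = 0 := hsupp q x (not_lt.1 fun h => hpq (hdisj p hp q hq x hx h))
        have h3 := hg p x y
        have h4 := hg q x y
        rw [h1] at h3
        rw [h2] at h4
        rw [abs_le] at *
        constructor <;> linarith [h3.1, h3.2, h4.1, h4.2]
    · push Not at hy
      rw [hG0 y hy, ← hsupp p y (hy p hp)]
      linarith [hg p x y]
  refine ⟨G, fun x y => ?_, hG, hG0⟩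
  by_cases hx : ∃ p ∈ N, dist x p < r p
  · obtain ⟨p, hp, hxp⟩ := hx
    rw [hG p hp x hxp]
    exact hone p hp x y hxp
  · by_cases hy : ∃ q ∈ N, dist y q < r q
    · obtain ⟨q, hq, hyq⟩ := hy
      rw [hG q hq y hyq, abs_sub_comm, dist_comm]
      exact hone q hq y x hyq
    · push Not at hx hy
      rw [hG0 x hx, hG0 y hy, sub_zero, abs_zero]
      positivity

/-- The cone of height `r` over `p`. -/
noncomputable def cone {X : Type*} [MetricSpace X] (p : X) (r : ℝ) (x : X) : ℝ :=
  max 0 (r - dist x p)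

theorem abs_cone_sub_cone_le {X : Type*} [MetricSpace X] (p : X) (r : ℝ) (x y : X) :
    |cone p r x - cone p r y| ≤ dist x y := by
  refine (abs_max_sub_max_le_max _ _ _ _).trans (max_le (by simp) ?_)
  rw [sub_sub_sub_cancel_left, abs_sub_comm]
  exact abs_dist_sub_le x y p

theorem cone_eq_zero {X : Type*} [MetricSpace X] {p : X} {r : ℝ} {x : X} (h : r ≤ dist x p) :
    cone p r x = 0 :=
  max_eq_left (by linarith)

/-- Truncation of a Lipschitz function vanishing at `p` to one supported in a ball. -/
theorem exists_truncation {X : Type*} [MetricSpace X] (p : X) (r : ℝ) (h : X → ℝ) {L : ℝ}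
    (hL : 0 ≤ L) (hh : ∀ x y, |h x - h y| ≤ L * dist x y) (hp : h p = 0) :
    ∃ g : X → ℝ, (∀ x y, |g x - g y| ≤ L * dist x y) ∧ (∀ x, r ≤ dist x p → g x = 0) ∧
      ∀ x, dist x p ≤ r / 2 → g x = h x := by
  have hb : ∀ x y, |L * cone p r x - L * cone p r y| ≤ L * dist x y := fun x y => by
    rw [← mul_sub, abs_mul, abs_of_nonneg hL]
    exact mul_le_mul_of_nonneg_left (abs_cone_sub_cone_le p r x y) hL
  refine ⟨fun x => max (-(L * cone p r x)) (min (L * cone p r x) (h x)),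
    fun x y => ?_, fun x hx => ?_, fun x hx => ?_⟩
  · refine (abs_max_sub_max_le_max _ _ _ _).trans (max_le ?_ ?_)
    · rw [neg_sub_neg, abs_sub_comm]
      exact hb x y
    · exact (abs_min_sub_min_le_max _ _ _ _).trans (max_le (hb x y) (hh x y))
  · simp only [cone_eq_zero hx, mul_zero, neg_zero]
    exact max_eq_left (min_le_left _ _)
  · have h1 := hh x p
    rw [hp, sub_zero] at h1
    have h2 : L * dist x p ≤ L * cone p r x :=
      mul_le_mul_of_nonneg_left (le_max_of_le_right (by linarith)) hL
    have h3 := abs_le.1 (h1.trans h2)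
    simp only [min_eq_right h3.2, max_eq_right h3.1]

/-- Real form of McShane's extension theorem. -/
theorem exists_lipschitz_extension {X : Type*} [MetricSpace X] (s : Set X) (f : X → ℝ) {L : ℝ}
    (hL : 0 ≤ L) (hf : ∀ x ∈ s, ∀ y ∈ s, |f x - f y| ≤ L * dist x y) :
    ∃ g : X → ℝ, (∀ x y, |g x - g y| ≤ L * dist x y) ∧ ∀ x ∈ s, g x = f x := by
  obtain ⟨g, hg, he⟩ := (LipschitzOnWith.of_dist_le_mul (K := ⟨L, hL⟩) hf).extend_real
  exact ⟨g, fun x y => hg.dist_le_mul x y, fun x hx => (he hx).symm⟩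

/-- A Whitney net of the complement of a closed set, coloured so that net points of the same
colour are far apart relative to their distance from the closed set. -/
theorem exists_colored_whitney_net (D c K : ℝ) (hD : 0 ≤ D) (hc : 0 < c) (hc1 : c ≤ 1)
    (hK : 0 ≤ K) :
    ∃ B : ℕ, ∀ (X : Type) [MetricSpace X] [MeasurableSpace X] [BorelSpace X]
      (μ : MeasureTheory.Measure X) (Y : Set X), IsDoublingMeasure μ D → Y.Nonempty →
      IsClosed Y → ∃ (N : Set X) (col : X → Fin (B + 1)), N ⊆ Yᶜ ∧
        (∀ x ∈ Yᶜ, ∃ p ∈ N, dist x p ≤ c * Metric.infDist p Y) ∧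
        ∀ p ∈ N, ∀ q ∈ N, dist p q ≤ K * Metric.infDist p Y →
          dist p q ≤ K * Metric.infDist q Y → col p = col q → p = q := by
  obtain ⟨B, hB⟩ := exists_packing_bound D (K * (K + 1) / (c / 2)) hD (by positivity)
  refine ⟨B, fun X _ _ _ μ Y hμ hYne hY => ?_⟩
  have hpos : ∀ x ∈ Yᶜ, 0 < Metric.infDist x Y := fun x hx =>
    (hY.notMem_iff_infDist_pos hYne).1 hx
  obtain ⟨N, hNY, hsep, hmax⟩ := exists_maximal_pairwise_subset Yᶜ
    (fun x y => c / 2 * max (Metric.infDist x Y) (Metric.infDist y Y) ≤ dist x y)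
    (fun x y h => by rwa [max_comm, dist_comm])
  obtain ⟨col, hcol⟩ := exists_coloring_of_bounded_degree (V := N)
    (fun p q => p ≠ q ∧ dist p q ≤ K * Metric.infDist (p : X) Y ∧
      dist p q ≤ K * Metric.infDist (q : X) Y)
    (fun p q h => ⟨h.1.symm, by rw [dist_comm]; exact h.2.2, by rw [dist_comm]; exact h.2.1⟩)
    (fun p h => h.1 rfl) B (fun p T hT => by
      have hp := hpos p (hNY p.2)
      rw [← Finset.card_map (Function.Embedding.subtype _)]
      refine hB X μ hμ p (c / 2 * (Metric.infDist (p : X) Y / (K + 1))) _ (by positivity) ?_ ?_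
      · intro q hq
        obtain ⟨q, hqT, rfl⟩ := Finset.mem_map.1 hq
        have h := (hT q hqT).2.1
        rw [dist_comm] at h
        refine h.trans (le_of_eq ?_)
        have : K + 1 ≠ 0 := by positivity
        field_simp
      · intro q hq q' hq' hne
        obtain ⟨q, hqT, rfl⟩ := Finset.mem_map.1 hq
        obtain ⟨q', hqT', rfl⟩ := Finset.mem_map.1 hq'
        refine le_trans ?_ (hsep q.2 q'.2 hne)
        gcongr
        refine le_max_of_le_left ?_
        rw [div_le_iff₀ (by positivity)]
        have h := (hT q hqT).2.2
        have h' : Metric.infDist (p : X) Y ≤ Metric.infDist (q : X) Y + dist (p : X) q :=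
          Metric.infDist_le_infDist_add_dist
        change dist (p : X) q ≤ _ at h
        linarith)
  classical
  refine ⟨N, fun x => if h : x ∈ N then col ⟨x, h⟩ else 0, hNY, fun x hx => ?_, ?_⟩
  · rcases hmax x hx with h | ⟨p, hp, h⟩
    · exact ⟨x, h, by rw [dist_self]; exact mul_nonneg hc.le Metric.infDist_nonneg⟩
    · refine ⟨p, hp, ?_⟩
      push Not at h
      have hp' := hpos p (hNY hp)
      have h1 : Metric.infDist x Y ≤ Metric.infDist p Y + dist x p :=
        Metric.infDist_le_infDist_add_dist
      rcases max_cases (Metric.infDist x Y) (Metric.infDist p Y) with ⟨hm, -⟩ | ⟨hm, -⟩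
      · rw [hm] at h
        nlinarith [hpos x hx, dist_nonneg (x := x) (y := p)]
      · rw [hm] at h
        nlinarith
  · intro p hp q hq h1 h2 heq
    by_contra hne
    simp only [dif_pos hp, dif_pos hq] at heq
    exact hcol ⟨p, hp⟩ ⟨q, hq⟩ ⟨fun h => hne (congrArg Subtype.val h), h1, h2⟩ heq

theorem setDist_le_dist {X : Type*} [MetricSpace X] {s t : Set X} {x y : X} (hx : x ∈ s)
    (hy : y ∈ t) : setDist s t ≤ dist x y :=
  csInf_le ⟨0, by rintro _ ⟨a, -, b, -, rfl⟩; exact dist_nonneg⟩ (Set.mem_image2_of_mem hx hy)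

section ChristWhitney

variable {X : Type*} [MetricSpace X] [MeasurableSpace X] {μ : MeasureTheory.Measure X}
  {Y : Set X} {A δ a₀ C₁ D : ℝ} {M : Set (Set X)}

theorem ChristWhitney.exists_mem_dist_lt (hM : ChristWhitney μ Y A δ a₀ C₁ M)
    (hμ : IsDoublingMeasure μ D) (hY : IsClosed Y) {x : X} (hx : x ∈ Yᶜ) {r : ℝ} (hr : 0 < r) :
    ∃ Q ∈ M, ∃ q ∈ Q, dist q x < r := by
  by_contra! h
  obtain ⟨s, hs, hsY⟩ := Metric.isOpen_iff.1 hY.isOpen_compl x hx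
  refine (hμ.1 x (min r s) (lt_min hr hs)).1.ne' (MeasureTheory.measure_mono_null ?_
    hM.almostCover)
  intro y hy
  have hy' := lt_min_iff.1 (Metric.mem_ball.1 hy)
  refine ⟨hsY hy'.2, fun hyU => ?_⟩
  obtain ⟨Q, hQ, hyQ⟩ := Set.mem_iUnion₂.1 hyU
  exact absurd hy'.1 (not_lt.2 (h Q hQ y hyQ))

theorem ChristWhitney.infDist_le_diam (hM : ChristWhitney μ Y A δ a₀ C₁ M) (hY : Y.Nonempty)
    {Q : Set X} (hQ : Q ∈ M) {q : X} (hq : q ∈ Q) :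
    Metric.infDist q Y ≤ (4 * C₁ * A / δ + 1) * Metric.diam Q := by
  obtain ⟨x, -, k, -, hk⟩ := hM.quasiball Q hQ
  have hb : Bornology.IsBounded Q := Metric.isBounded_ball.subset hk
  have h : Metric.infDist q Y - Metric.diam Q ≤ setDist Q Y := by
    refine le_csInf (Set.Nonempty.image2 ⟨q, hq⟩ hY) ?_
    rintro _ ⟨u, hu, v, hv, rfl⟩
    have h1 := Metric.infDist_le_dist_of_mem (x := q) hv
    have h2 := dist_triangle q u v
    have h3 := Metric.dist_le_diam_of_mem hb hq hu
    linarith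
  linarith [hM.dist_le_diam Q hQ]

/-- Every small ball of Whitney size is, up to the boundaries of the cubes, contained in
a single set `Q**`. -/
theorem ChristWhitney.exists_subset_dstar2Q (hM : ChristWhitney μ Y A δ a₀ C₁ M)
    (hμ : IsDoublingMeasure μ D) (hYne : Y.Nonempty) (hY : IsClosed Y)
    (hκ : 0 ≤ 4 * C₁ * A / δ) {ε : ℝ} (hε : ε ∈ Set.Ioo (0 : ℝ) 1) {p : X} (hp : p ∈ Yᶜ) :
    ∃ Q ∈ M, ∀ R ∈ M, ∀ y ∈ R,
      dist y p < ε / (4 * (4 * C₁ * A / δ + 1)) * Metric.infDist p Y →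
        y ∈ dstar2Q ε M Q := by
  set κ := 4 * C₁ * A / δ with hκ_def
  set d := Metric.infDist p Y with hd
  have hdpos : 0 < d := (hY.notMem_iff_infDist_pos hYne).1 hp
  have hε0 := hε.1
  have hrpos : 0 < ε / (4 * (κ + 1)) * d := by positivity
  have hr2 : ε / (4 * (κ + 1)) * d ≤ d / 2 := by
    have : ε / (4 * (κ + 1)) ≤ 1 / 2 := by
      rw [div_le_iff₀ (by positivity)]
      linarith [hε.2]
    nlinarith
  have hdiam : ∀ R ∈ M, ∀ y ∈ R, dist y p < ε / (4 * (κ + 1)) * d →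
      d / (2 * (κ + 1)) ≤ Metric.diam R := by
    intro R hR y hy hyp
    have h1 := hM.infDist_le_diam hYne hR hy
    rw [← hκ_def] at h1
    have h2 : d ≤ Metric.infDist y Y + dist p y := Metric.infDist_le_infDist_add_dist
    rw [dist_comm] at h2
    rw [div_le_iff₀ (by positivity)]
    linarith
  obtain ⟨Q, hQ, q, hq, hqp⟩ := hM.exists_mem_dist_lt hμ hY hp hrpos
  refine ⟨Q, hQ, fun R hR y hy hyp => ?_⟩
  have hQd := hdiam Q hQ q hq hqp
  have hRd := hdiam R hR y hy hyp
  have hlow : 0 < d / (2 * (κ + 1)) := by positivity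
  have hstar : R ∈ starQ ε M Q := by
    refine ⟨hR, ?_⟩
    calc setDist Q R ≤ dist q y := setDist_le_dist hq hy
      _ ≤ dist q p + dist y p := dist_triangle_right _ _ _
      _ < ε / (4 * (κ + 1)) * d + ε / (4 * (κ + 1)) * d := add_lt_add hqp hyp
      _ = ε * (d / (2 * (κ + 1))) := by field_simp; ring
      _ ≤ _ := by
          gcongr
          exact le_min hQd hRd
  refine Set.mem_iUnion₂.2 ⟨R, ⟨hR, R, hstar, ?_⟩, hy⟩
  calc setDist R R ≤ dist y y := setDist_le_dist hy hy
    _ = 0 := dist_self y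
    _ < _ := by
        rw [min_self]
        exact mul_pos hε0 (hlow.trans_le hRd)

/-- Around each point of the complement of `Y`, the embeddings of the sets `Q**` give
Lipschitz functions that are bi-Lipschitz on a ball of Whitney size. -/
theorem ChristWhitney.exists_local_chart (hM : ChristWhitney μ Y A δ a₀ C₁ M)
    (hμ : IsDoublingMeasure μ D) (hYne : Y.Nonempty) (hY : IsClosed Y)
    (hκ : 0 ≤ 4 * C₁ * A / δ) {ε : ℝ} (hε : ε ∈ Set.Ioo (0 : ℝ) 1) {m : ℕ} {L : ℝ}
    (hL : 1 ≤ L)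
    (hemb : ∀ Q ∈ M, ∃ h : X → EuclideanSpace ℝ (Fin m), BiLipschitzOn h (dstar2Q ε M Q) L)
    {p : X} (hp : p ∈ Yᶜ) :
    ∃ h : Fin m → X → ℝ, (∀ i x y, |h i x - h i y| ≤ L * dist x y) ∧ (∀ i, h i p = 0) ∧
      ∀ y z, dist y p < ε / (4 * (4 * C₁ * A / δ + 1)) * Metric.infDist p Y →
        dist z p < ε / (4 * (4 * C₁ * A / δ + 1)) * Metric.infDist p Y →
        dist y z ≤ L * ∑ i, |h i y - h i z| := by
  obtain ⟨Q, hQ, hsub⟩ := hM.exists_subset_dstar2Q hμ hYne hY hκ hε hp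
  obtain ⟨H, hH⟩ := hemb Q hQ
  have hL0 : 0 < L := by linarith
  have hcoord : ∀ i, ∃ g : X → ℝ, (∀ x y, |g x - g y| ≤ L * dist x y) ∧
      ∀ x ∈ dstar2Q ε M Q, g x = H x i := fun i =>
    exists_lipschitz_extension _ (fun x => H x i) hL0.le fun x hx y hy =>
      (EuclideanSpace.abs_sub_le_dist _ _ i).trans (hH x hx y hy).2
  choose g hg hgH using hcoord
  set r := ε / (4 * (4 * C₁ * A / δ + 1)) * Metric.infDist p Y with hr
  have hrd : r ≤ Metric.infDist p Y := by
    have : ε / (4 * (4 * C₁ * A / δ + 1)) ≤ 1 := by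
      rw [div_le_iff₀ (by positivity)]
      linarith [hε.2]
    exact mul_le_of_le_one_left Metric.infDist_nonneg this
  refine ⟨fun i x => g i x - g i p, fun i x y => by simpa using hg i x y, by simp, ?_⟩
  intro y z hy hz
  simp only [sub_sub_sub_cancel_right]
  have happrox : ∀ y, dist y p < r → ∀ η > 0, ∃ y' ∈ dstar2Q ε M Q, dist y' y < η := by
    intro y hy η hη
    have hyY : y ∈ Yᶜ := fun h => by
      have := Metric.infDist_le_dist_of_mem (x := p) h
      rw [dist_comm] at this
      linarith
    obtain ⟨R, hR, y', hy', hlt⟩ := hM.exists_mem_dist_lt hμ hY hyY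
      (lt_min hη (sub_pos.2 hy))
    obtain ⟨h1, h2⟩ := lt_min_iff.1 hlt
    exact ⟨y', hsub R hR y' hy' (by linarith [dist_triangle y' y p]), h1⟩
  refine le_of_forall_pos_le_add fun η hη => ?_
  have hden : 0 < 2 * L * (m * L) + 2 := by positivity
  obtain ⟨y', hy', hyy'⟩ := happrox y hy (η / (2 * L * (m * L) + 2)) (by positivity)
  obtain ⟨z', hz', hzz'⟩ := happrox z hz (η / (2 * L * (m * L) + 2)) (by positivity)
  set θ := η / (2 * L * (m * L) + 2) with hθ
  have h1 : dist y' z' ≤ L * ∑ i, |g i y' - g i z'| := by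
    have h2 := (inv_mul_le_iff₀ hL0).1 (hH y' hy' z' hz').1
    refine h2.trans (mul_le_mul_of_nonneg_left ?_ hL0.le)
    refine (EuclideanSpace.dist_le_sum_abs _ _).trans (le_of_eq ?_)
    exact Finset.sum_congr rfl fun i _ => by rw [hgH i y' hy', hgH i z' hz']
  have h2 : ∑ i, |g i y' - g i z'| ≤ ∑ i, |g i y - g i z| + m * (2 * L * θ) := by
    have : ∀ i ∈ Finset.univ, |g i y' - g i z'| ≤ |g i y - g i z| + 2 * L * θ := by
      intro i _
      have a1 := (hg i y' y).trans (mul_le_mul_of_nonneg_left hyy'.le hL0.le)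
      have a2 := (hg i z' z).trans (mul_le_mul_of_nonneg_left hzz'.le hL0.le)
      have a3 := abs_le.1 (le_refl |g i y - g i z|)
      rw [abs_le] at a1 a2 ⊢
      constructor <;> linarith [a1.1, a1.2, a2.1, a2.2, a3.1, a3.2]
    refine (Finset.sum_le_sum this).trans (le_of_eq ?_)
    simp [Finset.sum_add_distrib]
  have h3 : dist y z ≤ dist y' z' + 2 * θ := by
    have := dist_triangle4 y y' z' z
    rw [dist_comm y y'] at this
    linarith
  have h4 : η = (2 * L * (m * L) + 2) * θ := by
    rw [hθ]
    field_simp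
  have h5 := mul_le_mul_of_nonneg_left h2 hL0.le
  rw [h4]
  nlinarith

end ChristWhitney

/-- A bi-Lipschitz embedding of `Y` extends to Lipschitz functions on `X` that detect the
distance of pairs of points which are far apart relative to their distance from `Y`. -/
theorem exists_extension_detecting_far_pairs {X : Type*} [MetricSpace X] {Y : Set X}
    (hYne : Y.Nonempty) (hY : IsClosed Y) {m : ℕ} {L : ℝ} (hL : 1 ≤ L)
    {f : X → EuclideanSpace ℝ (Fin m)} (hf : BiLipschitzOn f Y L) :
    ∃ g : Fin m → X → ℝ, (∀ i x y, |g i x - g i y| ≤ L * dist x y) ∧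
      ∀ x y, 0 < dist x y →
        16 * L ^ 2 * (m + 1) * max (Metric.infDist x Y) (Metric.infDist y Y) ≤ dist x y →
        ∃ i, dist x y ≤ 2 * L * (m + 1) * |g i x - g i y| := by
  have hL0 : 0 < L := by linarith
  have hcoord : ∀ i, ∃ g : X → ℝ, (∀ x y, |g x - g y| ≤ L * dist x y) ∧
      ∀ x ∈ Y, g x = f x i := fun i =>
    exists_lipschitz_extension _ (fun x => f x i) hL0.le fun x hx y hy =>
      (EuclideanSpace.abs_sub_le_dist _ _ i).trans (hf x hx y hy).2
  choose g hg hgf using hcoord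
  refine ⟨g, hg, fun x y hxy hfar => ?_⟩
  set d := max (Metric.infDist x Y) (Metric.infDist y Y) with hd
  have hproj : ∀ x, ∃ x' ∈ Y, dist x x' ≤ 2 * Metric.infDist x Y := by
    intro x
    by_cases hx : x ∈ Y
    · exact ⟨x, hx, by simp [Metric.infDist_nonneg]⟩
    · have hpos := (hY.notMem_iff_infDist_pos hYne).1 hx
      obtain ⟨x', hx', hlt⟩ := (Metric.infDist_lt_iff hYne).1
        (by linarith : Metric.infDist x Y < 2 * Metric.infDist x Y)
      exact ⟨x', hx', hlt.le⟩
  obtain ⟨x', hx', hxx'⟩ := hproj x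
  obtain ⟨y', hy', hyy'⟩ := hproj y
  have hxd : dist x x' ≤ 2 * d := hxx'.trans (by gcongr; exact le_max_left _ _)
  have hyd : dist y y' ≤ 2 * d := hyy'.trans (by gcongr; exact le_max_right _ _)
  have hd0 : 0 ≤ d := le_max_of_le_left Metric.infDist_nonneg
  have hm : (1 : ℝ) ≤ m + 1 := by linarith [(Nat.cast_nonneg m : (0 : ℝ) ≤ m)]
  have hLL : 1 ≤ L ^ 2 := one_le_pow₀ hL
  have hLm : 1 ≤ L ^ 2 * (m + 1) := one_le_mul_of_one_le_of_one_le hLL hm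
  have h16 : 16 * d ≤ dist x y := by nlinarith
  have h4 : dist x y ≤ dist x' y' + 4 * d := by
    have := dist_triangle4 x x' y' y
    rw [dist_comm y' y] at this
    linarith
  have hlow : 3 / 4 * dist x y ≤ L * ∑ i, |f x' i - f y' i| := by
    have h2 := (inv_mul_le_iff₀ hL0).1 (hf x' hx' y' hy').1
    have h3 := mul_le_mul_of_nonneg_left (EuclideanSpace.dist_le_sum_abs (f x') (f y')) hL0.le
    linarith
  rw [Finset.mul_sum] at hlow
  obtain ⟨i, hi⟩ := exists_le_mul_of_le_sum _ (by positivity) hlow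
  refine ⟨i, ?_⟩
  have h5 : |f x' i - f y' i| ≤ |g i x - g i y| + 4 * L * d := by
    rw [← hgf i x' hx', ← hgf i y' hy']
    have a1 := (hg i x x').trans (mul_le_mul_of_nonneg_left hxd hL0.le)
    have a2 := (hg i y y').trans (mul_le_mul_of_nonneg_left hyd hL0.le)
    have a3 := abs_le.1 (le_refl |g i x - g i y|)
    rw [abs_le] at a1 a2 ⊢
    constructor <;> linarith [a1.1, a1.2, a2.1, a2.2, a3.1, a3.2]
  have h6 : (m + 1) * (L * |f x' i - f y' i|) ≤
      (m + 1) * (L * (|g i x - g i y| + 4 * L * d)) := by gcongr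
  nlinarith

/-- The number of colours and the coordinate functions detecting pairs of points which are
close to each other relative to their distance from `Y`. -/
theorem exists_coordinates_detecting_near_pairs (D c K L : ℝ) (m : ℕ) (hD : 0 ≤ D) (hc : 0 < c)
    (hc4 : c ≤ 1 / 4) (hK : 0 ≤ K) (hL : 1 ≤ L) :
    ∃ B : ℕ, ∀ (X : Type) [MetricSpace X] [MeasurableSpace X] [BorelSpace X]
      (μ : MeasureTheory.Measure X) (Y : Set X), IsDoublingMeasure μ D → Y.Nonempty →
      IsClosed Y →
      (∀ p ∈ Yᶜ, ∃ h : Fin m → X → ℝ, (∀ i x y, |h i x - h i y| ≤ L * dist x y) ∧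
        (∀ i, h i p = 0) ∧ ∀ y z, dist y p < c * Metric.infDist p Y →
          dist z p < c * Metric.infDist p Y → dist y z ≤ L * ∑ i, |h i y - h i z|) →
      ∃ F : Fin (B + 1) × Option (Fin m) → X → ℝ,
        (∀ j x y, |F j x - F j y| ≤ 2 * L * dist x y) ∧
        ∀ x y, 0 < dist x y → Metric.infDist y Y ≤ Metric.infDist x Y →
          Metric.infDist x Y ≤ 2 * Metric.infDist y Y → dist x y ≤ K * Metric.infDist x Y →
          ∃ j, dist x y ≤ (L * (m + 1) + 8 * K / c) * |F j x - F j y| := by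
  obtain ⟨B, hB⟩ := exists_colored_whitney_net D (c / 4) (4 * K + 8) hD (by positivity)
    (by linarith) (by positivity)
  refine ⟨B, fun X _ _ _ μ Y hμ hYne hY hchart => ?_⟩
  obtain ⟨N, col, hNY, hcov, hcol⟩ := hB X μ Y hμ hYne hY
  have hL0 : 0 < L := by linarith
  choose! h hhL hhp hhlow using hchart
  set r : X → ℝ := fun p => c * Metric.infDist p Y with hr
  have hcompare : ∀ p x, dist x p < r p →
      Metric.infDist p Y ≤ 2 * Metric.infDist x Y ∧ Metric.infDist x Y ≤ 2 * Metric.infDist p Y := by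
    intro p x hx
    have h1 : Metric.infDist x Y ≤ Metric.infDist p Y + dist x p :=
      Metric.infDist_le_infDist_add_dist
    have h2 : Metric.infDist p Y ≤ Metric.infDist x Y + dist p x :=
      Metric.infDist_le_infDist_add_dist
    rw [dist_comm] at h2
    have h3 : r p ≤ 1 / 4 * Metric.infDist p Y :=
      mul_le_mul_of_nonneg_right hc4 Metric.infDist_nonneg
    have h4 : 0 ≤ Metric.infDist p Y := Metric.infDist_nonneg
    constructor <;> linarith
  have hradius : ∀ p, r p ≤ 1 / 4 * Metric.infDist p Y := fun p =>
    mul_le_mul_of_nonneg_right hc4 Metric.infDist_nonneg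
  have hunique : ∀ p ∈ N, ∀ q ∈ N, col p = col q → ∀ x y, dist x p < r p → dist y q < r q →
      Metric.infDist y Y ≤ Metric.infDist x Y → Metric.infDist x Y ≤ 2 * Metric.infDist y Y →
      dist x y ≤ K * Metric.infDist x Y → p = q := by
    intro p hp q hq hpq x y hx hy h1 h2 h3
    obtain ⟨a1, a2⟩ := hcompare p x hx
    obtain ⟨b1, b2⟩ := hcompare q y hy
    have ht := dist_triangle4 p x y q
    rw [dist_comm p x] at ht
    have hrp := hradius p
    have hrq := hradius q
    have hp0 : 0 ≤ Metric.infDist p Y := Metric.infDist_nonneg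
    have hq0 : 0 ≤ Metric.infDist q Y := Metric.infDist_nonneg
    have k1 : K * Metric.infDist x Y ≤ K * (2 * Metric.infDist p Y) := by gcongr
    have k2 : K * Metric.infDist x Y ≤ K * (4 * Metric.infDist q Y) := by gcongr; linarith
    have k3 : 0 ≤ K * Metric.infDist p Y := by positivity
    exact hcol p hp q hq (by nlinarith) (by nlinarith) hpq
  have hdisj : ∀ k, ∀ p ∈ {p ∈ N | col p = k}, ∀ q ∈ {p ∈ N | col p = k}, ∀ x,
      dist x p < r p → dist x q < r q → p = q := by
    rintro k p ⟨hp, hpk⟩ q ⟨hq, hqk⟩ x hxp hxq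
    refine hunique p hp q hq (hpk.trans hqk.symm) x x hxp hxq le_rfl ?_ ?_
    · linarith [Metric.infDist_nonneg (x := x) (s := Y)]
    · rw [dist_self]
      exact mul_nonneg hK Metric.infDist_nonneg
  have hbump : ∀ k, ∃ G : X → ℝ, (∀ x y, |G x - G y| ≤ 2 * L * dist x y) ∧
      (∀ p ∈ {p ∈ N | col p = k}, ∀ x, dist x p < r p → G x = cone p (r p) x) ∧
      ∀ x, (∀ p ∈ {p ∈ N | col p = k}, r p ≤ dist x p) → G x = 0 := fun k =>
    exists_glue_of_disjoint_balls _ r (fun p => cone p (r p)) hL0.le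
      (fun p x y => (abs_cone_sub_cone_le p (r p) x y).trans
        (le_mul_of_one_le_left dist_nonneg hL)) (fun p x hx => cone_eq_zero hx) (hdisj k)
  choose b hbL hb hb0 using hbump
  have htrunc : ∀ p i, ∃ g : X → ℝ, (∀ x y, |g x - g y| ≤ L * dist x y) ∧
      (∀ x, r p ≤ dist x p → g x = 0) ∧ (p ∈ Yᶜ → ∀ x, dist x p ≤ r p / 2 → g x = h p i x) := by
    intro p i
    by_cases hp : p ∈ Yᶜ
    · obtain ⟨g, h1, h2, h3⟩ := exists_truncation p (r p) (h p i) hL0.le (hhL p hp i) (hhp p hp i)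
      exact ⟨g, h1, h2, fun _ => h3⟩
    · exact ⟨fun _ => 0, fun x y => by simp; positivity, fun _ _ => rfl, fun h => absurd h hp⟩
  choose t htL ht0 hth using htrunc
  have hglue : ∀ k i, ∃ G : X → ℝ, (∀ x y, |G x - G y| ≤ 2 * L * dist x y) ∧
      (∀ p ∈ {p ∈ N | col p = k}, ∀ x, dist x p < r p → G x = t p i x) ∧
      ∀ x, (∀ p ∈ {p ∈ N | col p = k}, r p ≤ dist x p) → G x = 0 := fun k i =>
    exists_glue_of_disjoint_balls _ r (fun p => t p i) hL0.le (fun p => htL p i)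
      (fun p => ht0 p i) (hdisj k)
  choose G hGL hG _ using hglue
  refine ⟨fun j => j.2.elim (b j.1) (G j.1), ?_, ?_⟩
  · rintro ⟨k, _ | i⟩ x y
    · exact hbL k x y
    · exact hGL k i x y
  intro x y hxy hyx hxy2 hK'
  have hx : x ∈ Yᶜ := fun hx => by
    rw [Metric.infDist_zero_of_mem hx, mul_zero] at hK'
    linarith
  obtain ⟨p, hp, hxp⟩ := hcov x hx
  have hpY := hNY hp
  have hp0 : 0 < Metric.infDist p Y := (hY.notMem_iff_infDist_pos hYne).1 hpY
  have hrp : 0 < r p := mul_pos hc hp0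
  have hxp4 : dist x p ≤ r p / 4 := hxp.trans (le_of_eq (by rw [hr]; ring))
  by_cases hyp : dist y p < r p / 2
  · obtain ⟨i, hi⟩ := exists_le_mul_of_le_sum (fun i => L * |h p i x - h p i y|) hxy
      (by
        rw [← Finset.mul_sum]
        exact hhlow p hpY x y (show dist x p < r p by linarith) (show dist y p < r p by linarith))
    refine ⟨(col p, some i), ?_⟩
    change _ ≤ _ * |G (col p) i x - G (col p) i y|
    rw [hG _ i p ⟨hp, rfl⟩ x (by linarith), hG _ i p ⟨hp, rfl⟩ y (by linarith),
      hth p i hpY x (by linarith), hth p i hpY y hyp.le]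
    have : 0 ≤ 8 * K / c * |h p i x - h p i y| := by positivity
    linarith
  · push Not at hyp
    refine ⟨(col p, none), ?_⟩
    change _ ≤ _ * |b (col p) x - b (col p) y|
    have hbx : 3 / 4 * r p ≤ b (col p) x := by
      rw [hb _ p ⟨hp, rfl⟩ x (by linarith)]
      exact le_max_of_le_right (by linarith)
    have hby : b (col p) y ≤ r p / 2 := by
      by_cases hy : ∃ q ∈ {q ∈ N | col q = col p}, dist y q < r q
      · obtain ⟨q, hq, hyq⟩ := hy
        have hpq : p = q := hunique p hp q hq.1 hq.2.symm x y (by linarith) hyq hyx hxy2 hK'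
        subst hpq
        rw [hb _ p hq y hyq]
        exact max_le (by linarith) (by linarith)
      · push Not at hy
        rw [hb0 _ y hy]
        linarith
    have hgap : r p / 4 ≤ |b (col p) x - b (col p) y| := (by linarith : r p / 4 ≤
      b (col p) x - b (col p) y).trans (le_abs_self _)
    have hxd := (hcompare p x (by linarith)).2
    calc dist x y ≤ K * Metric.infDist x Y := hK'
      _ ≤ K * (2 * Metric.infDist p Y) := by gcongr
      _ = 8 * K / c * (r p / 4) := by
          simp only [hr]
          field_simp
          ring
      _ ≤ 8 * K / c * |b (col p) x - b (col p) y| := by gcongr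
      _ ≤ _ := by
          gcongr
          exact le_add_of_nonneg_left (by positivity)

/-- A uniformly perfect complete metric space carrying a doubling measure,
a bi-Lipschitzly embeddable closed subset `Y`, and a Christ–Whitney decomposition of
`Ω = X \ Y` all of whose dilated cubes `Q**` admit uniformly bi-Lipschitz embeddings into
a fixed Euclidean space, itself admits a bi-Lipschitz embedding into some Euclidean space,
with constant and dimension depending only on the data. -/
theorem statement0 (A D δ a₀ C₁ ε L₁ L₂ : ℝ) (M₁ M₂ : ℕ)
    (hA : 1 ≤ A) (hD : 1 ≤ D) (hδ : δ ∈ Set.Ioo (0:ℝ) 1)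
    (ha₀ : a₀ ∈ Set.Ioo (0:ℝ) 1) (hC₁ : 0 < C₁) (hε : ε ∈ Set.Ioo (0:ℝ) 1)
    (hL₁ : 1 ≤ L₁) (hL₂ : 1 ≤ L₂) :
    ∃ (n : ℕ) (L : ℝ), 1 ≤ L ∧
      ∀ (X : Type) [MetricSpace X] [CompleteSpace X] [MeasurableSpace X]
        [BorelSpace X] (μ : MeasureTheory.Measure X) (Y : Set X)
        (M : Set (Set X)),
        UniformlyPerfect X A →
        IsDoublingMeasure μ D →
        Y.Nonempty → IsClosed Y →
        ChristWhitney μ Y A δ a₀ C₁ M →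
        (∃ f : X → EuclideanSpace ℝ (Fin M₁), BiLipschitzOn f Y L₁) →
        (∀ Q ∈ M, ∃ h : X → EuclideanSpace ℝ (Fin M₂),
          BiLipschitzOn h (dstar2Q ε M Q) L₂) →
        ∃ F : X → EuclideanSpace ℝ (Fin n), BiLipschitzOn F Set.univ L := by
  obtain ⟨hδ0, -⟩ := hδ
  have hκ : 0 ≤ 4 * C₁ * A / δ := by positivity
  set c := ε / (4 * (4 * C₁ * A / δ + 1)) with hc
  have hc0 : 0 < c := div_pos hε.1 (by positivity)
  have hc4 : c ≤ 1 / 4 := by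
    rw [hc, div_le_iff₀ (by positivity)]
    linarith [hε.2]
  set K := 16 * L₁ ^ 2 * (M₁ + 1) with hK
  have hK0 : 0 ≤ K := by positivity
  obtain ⟨B, hB⟩ := exists_coordinates_detecting_near_pairs D c K L₂ M₂ (by linarith) hc0 hc4
    hK0 hL₂
  set P := 2 * L₁ * (M₁ + 1) + 2 * K + (L₂ * (M₂ + 1) + 8 * K / c) with hP
  have hP0 : 0 ≤ P := by positivity
  let ι := Option (Fin M₁ ⊕ Fin (B + 1) × Option (Fin M₂))
  refine ⟨Fintype.card ι, Fintype.card ι * (L₁ + 2 * L₂) + P + 1, ?_,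
    fun X _ _ _ _ μ Y M _ hμ hYne hY hM hf hh => ?_⟩
  · have : 0 ≤ (Fintype.card ι : ℝ) * (L₁ + 2 * L₂) := by positivity
    linarith
  obtain ⟨f, hf⟩ := hf
  obtain ⟨g, hgL, hg⟩ := exists_extension_detecting_far_pairs hYne hY hL₁ hf
  obtain ⟨F, hFL, hF⟩ := hB X μ Y hμ hYne hY fun p hp =>
    hM.exists_local_chart hμ hYne hY hκ hε hL₂ hh hp
  let Φ : ι → X → ℝ := fun j => j.elim (fun x => Metric.infDist x Y) (Sum.elim g F)
  refine exists_biLipschitzOn_univ_of_coordinates Φ (by positivity) hP0 ?_ ?_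
  · rintro (_ | i | j) x y
    · have h1 := (Metric.lipschitz_infDist_pt Y).dist_le_mul x y
      rw [NNReal.coe_one, one_mul, Real.dist_eq] at h1
      exact h1.trans (le_mul_of_one_le_left dist_nonneg (by linarith))
    · refine (hgL i x y).trans ?_
      gcongr
      linarith
    · refine (hFL j x y).trans ?_
      gcongr
      linarith
  have hP1 : 0 ≤ 2 * L₁ * (M₁ + 1) := by positivity
  have hP2 : 0 ≤ L₂ * (M₂ + 1) + 8 * K / c := by positivity
  intro x y
  wlog hyx : Metric.infDist y Y ≤ Metric.infDist x Y generalizing x y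
  · obtain ⟨j, hj⟩ := this y x (not_le.1 hyx).le
    exact ⟨j, by rwa [dist_comm, abs_sub_comm]⟩
  rcases eq_or_lt_of_le (dist_nonneg (x := x) (y := y)) with h0 | hpos
  · exact ⟨none, by rw [← h0]; positivity⟩
  by_cases hfar : K * Metric.infDist x Y ≤ dist x y
  · obtain ⟨i, hi⟩ := hg x y hpos (by rwa [max_eq_left hyx])
    exact ⟨some (Sum.inl i),
      hi.trans (mul_le_mul_of_nonneg_right (by linarith) (abs_nonneg _))⟩
  push Not at hfar
  by_cases hcomp : Metric.infDist x Y ≤ 2 * Metric.infDist y Y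
  · obtain ⟨j, hj⟩ := hF x y hpos hyx hcomp hfar.le
    exact ⟨some (Sum.inr j),
      hj.trans (mul_le_mul_of_nonneg_right (by linarith) (abs_nonneg _))⟩
  · refine ⟨none, ?_⟩
    have hgap : Metric.infDist x Y ≤ 2 * |Metric.infDist x Y - Metric.infDist y Y| := by
      linarith [le_abs_self (Metric.infDist x Y - Metric.infDist y Y)]
    calc dist x y ≤ K * (2 * |Metric.infDist x Y - Metric.infDist y Y|) :=
          hfar.le.trans (by gcongr)
      _ = 2 * K * |Metric.infDist x Y - Metric.infDist y Y| := by ring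
      _ ≤ P * |Metric.infDist x Y - Metric.infDist y Y| := by
          gcongr
          linarith
end

section
/- Let (X,d) be an A-uniformly perfect complete metric space carrying a D-doubling Borel measure μ, let Y ⊆ X be a nonempty closed subset and Ω = X ∖ Y. Suppose that (a) there exist M₁ ∈ ℕ, L₁ ≥ 1 and an L₁-bi-Lipschitz embedding f : Y → ℝ^{M₁}; and (b) there exist a Christ–Whitney decomposition M of Ω with constants δ, a₀ ∈ (0,1), C₁ > 0, a number ε ∈ (0,1), and M₂ ∈ ℕ, L₂ ≥ 1 such that for every Q ∈ M the set Q** admits an L₂-bi-Lipschitz embedding into ℝ^{M₂}. Then there exist n ∈ ℕ, L ≥ 1, depending only on A, D, δ, a₀, C₁, ε, M₁, M₂, L₁, L₂, and an L-bi-Lipschitz embedding of the full-measure set (⋃_{Q∈M} Q) ∪ Y into ℝⁿ. -/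
/-- Greedy colouring of a countable symmetric relation whose vertices have at most `n`
neighbours. -/
theorem exists_coloring_of_degree_le {ι : Type*} [Countable ι] (r : ι → ι → Prop)
    (hsymm : ∀ i j, r i j → r j i) (n : ℕ)
    (hdeg : ∀ (i : ι) (t : Finset ι), (∀ j ∈ t, r i j) → t.card ≤ n) :
    ∃ c : ι → Fin (n + 1), ∀ i j, i ≠ j → r i j → c i ≠ c j := by
  classical
  obtain ⟨e, he⟩ := Countable.exists_injective_nat ι
  have free : ∀ (i : ι) (g : ∀ j, e j < e i → Fin (n + 1)),
      ∃ x, ∀ j (hj : e j < e i), r i j → x ≠ g j hj := by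
    intro i g
    by_contra! hcon
    choose v hv hr hg using hcon
    have hinj : Function.Injective v := by
      intro x y hxy
      rw [hg x, hg y]
      congr 1
    have := hdeg i (Finset.univ.image v) (by
      intro j hj
      obtain ⟨x, -, rfl⟩ := Finset.mem_image.1 hj
      exact hr x)
    rw [Finset.card_image_of_injective _ hinj, Finset.card_univ, Fintype.card_fin] at this
    omega
  choose pick hpick using free
  let c : ι → Fin (n + 1) := (measure e).wf.fix pick
  have hc : ∀ i, c i = pick i fun j _ => c j := fun i => (measure e).wf.fix_eq pick i
  have key : ∀ i j, e j < e i → r i j → c i ≠ c j := by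
    intro i j hj hr
    rw [hc i]
    exact hpick i (fun j _ => c j) j hj hr
  refine ⟨c, fun i j hij hr => ?_⟩
  rcases lt_or_gt_of_ne (he.ne hij) with h | h
  · exact (key j i h (hsymm i j hr)).symm
  · exact key i j h hr

/-- Lipschitz functions with pairwise disjoint supports glue to a Lipschitz function. -/
theorem exists_lipschitz_glue {ι X E : Type*} [PseudoMetricSpace X] [NormedAddCommGroup E]
    (u : ι → X → E) (S : ι → Set X) (K : ℝ)
    (hS : ∀ z i j, z ∈ S i → z ∈ S j → i = j)
    (hu : ∀ i, ∀ z ∉ S i, u i z = 0)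
    (hK : ∀ i x y, dist (u i x) (u i y) ≤ K * dist x y) (hK0 : 0 ≤ K) :
    ∃ U : X → E, (∀ x y, dist (U x) (U y) ≤ 2 * K * dist x y) ∧
      (∀ i, ∀ z ∈ S i, U z = u i z) ∧ (∀ z, (∀ i, z ∉ S i) → U z = 0) := by
  classical
  let U : X → E := fun z => if h : ∃ i, z ∈ S i then u h.choose z else 0
  have h1 : ∀ i, ∀ z ∈ S i, U z = u i z := by
    intro i z hz
    have h : ∃ i, z ∈ S i := ⟨i, hz⟩
    simp only [U, dif_pos h]
    rw [hS z _ i h.choose_spec hz]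
  have h2 : ∀ z, (∀ i, z ∉ S i) → U z = 0 := by
    intro z hz
    have h : ¬ ∃ i, z ∈ S i := by simpa using hz
    simp only [U, dif_neg h]
  have one : ∀ x y i, x ∈ S i → y ∉ S i → dist (u i x) 0 ≤ K * dist x y := by
    intro x y i _ hy
    have := hK i x y
    rwa [hu i y hy] at this
  have le2 : ∀ x y : X, K * dist x y ≤ 2 * K * dist x y := by
    intro x y
    nlinarith [mul_nonneg hK0 (dist_nonneg (x := x) (y := y))]
  refine ⟨U, fun x y => ?_, h1, h2⟩
  by_cases hx : ∃ i, x ∈ S i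
  · obtain ⟨i, hi⟩ := hx
    rw [h1 i x hi]
    by_cases hyi : y ∈ S i
    · rw [h1 i y hyi]
      exact (hK i x y).trans (le2 x y)
    · have ha := one x y i hi hyi
      by_cases hy : ∃ j, y ∈ S j
      · obtain ⟨j, hj⟩ := hy
        have hxj : x ∉ S j := fun h => hyi (hS x i j hi h ▸ hj)
        have hb := one y x j hj hxj
        rw [h1 j y hj]
        rw [dist_comm y x, dist_comm] at hb
        linarith [dist_triangle (u i x) 0 (u j y)]
      · rw [h2 y (by simpa using hy)]
        exact ha.trans (le2 x y)
  · rw [h2 x (by simpa using hx)]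
    by_cases hy : ∃ j, y ∈ S j
    · obtain ⟨j, hj⟩ := hy
      have hb := one y x j hj fun h => hx ⟨j, h⟩
      rw [h1 j y hj]
      rw [dist_comm y x, dist_comm] at hb
      exact hb.trans (le2 x y)
    · rw [h2 y (by simpa using hy), dist_self]
      positivity

theorem IsDoublingMeasure.measure_ball_two_pow_mul_le {X : Type*} [MetricSpace X]
    [MeasurableSpace X] {μ : MeasureTheory.Measure X} {D : ℝ} (h : IsDoublingMeasure μ D)
    (x : X) {r : ℝ} (hr : 0 < r) (m : ℕ) :
    μ (Metric.ball x (2 ^ m * r)) ≤ ENNReal.ofReal D ^ m * μ (Metric.ball x r) := by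
  induction m with
  | zero => simp
  | succ m ih =>
    have := h.2 x (2 ^ m * r) (by positivity)
    rw [pow_succ', mul_assoc, pow_succ', mul_assoc]
    exact this.trans (by gcongr)

/-- In a doubling space, a ball contains boundedly many disjoint sets containing balls of
comparable radius. -/
theorem IsDoublingMeasure.card_le_of_disjoint {X ι : Type*} [MetricSpace X]
    [MeasurableSpace X] [BorelSpace X] {μ : MeasureTheory.Measure X} {D : ℝ} (hD : 1 ≤ D)
    (h : IsDoublingMeasure μ D) {x₀ : X} {p : ι → X} {ρ σ : ℝ} {m n : ℕ} (hρ : 0 < ρ)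
    (t : Finset ι)
    (hdisj : (t : Set ι).PairwiseDisjoint fun i => Metric.ball (p i) ρ)
    (hp : ∀ i ∈ t, dist x₀ (p i) + ρ ≤ σ) (hm : 2 * σ ≤ 2 ^ m * ρ) (hn : D ^ m ≤ n) :
    t.card ≤ n := by
  rcases t.eq_empty_or_nonempty with rfl | ⟨i₀, hi₀⟩
  · simp
  have hσ : 0 < σ := by
    have := hp i₀ hi₀
    linarith [dist_nonneg (x := x₀) (y := p i₀)]
  obtain ⟨hpos, hfin⟩ := h.1 x₀ σ hσ
  set B := μ (Metric.ball x₀ σ)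
  have hone : ∀ i ∈ t, B ≤ ENNReal.ofReal D ^ m * μ (Metric.ball (p i) ρ) := by
    intro i hi
    refine le_trans (MeasureTheory.measure_mono ?_)
      (h.measure_ball_two_pow_mul_le (p i) hρ m)
    apply Metric.ball_subset_ball'
    have := hp i hi
    linarith
  have hsum : ∑ i ∈ t, μ (Metric.ball (p i) ρ) ≤ B := by
    rw [← MeasureTheory.measure_biUnion_finset hdisj fun i _ => measurableSet_ball]
    apply MeasureTheory.measure_mono
    refine Set.iUnion₂_subset fun i hi => Metric.ball_subset_ball' ?_
    have := hp i hi
    rw [dist_comm] at this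
    linarith
  have hle : (t.card : ENNReal) * B ≤ ENNReal.ofReal D ^ m * B := by
    calc (t.card : ENNReal) * B = ∑ i ∈ t, B := by rw [Finset.sum_const, nsmul_eq_mul]
      _ ≤ ∑ i ∈ t, ENNReal.ofReal D ^ m * μ (Metric.ball (p i) ρ) := Finset.sum_le_sum hone
      _ = ENNReal.ofReal D ^ m * ∑ i ∈ t, μ (Metric.ball (p i) ρ) := by rw [Finset.mul_sum]
      _ ≤ _ := by gcongr
  have h3 := (ENNReal.mul_le_mul_iff_left hpos.ne' hfin.ne).1 hle
  rw [← ENNReal.ofReal_pow (by linarith)] at h3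
  have h4 : (t.card : ENNReal) ≤ ENNReal.ofReal n := h3.trans (ENNReal.ofReal_le_ofReal hn)
  rw [ENNReal.ofReal_natCast] at h4
  exact_mod_cast h4

theorem exists_lipschitz_extension_s1 {X E : Type*} [PseudoMetricSpace X]
    [NormedAddCommGroup E] [NormedSpace ℝ E] [FiniteDimensional ℝ E] {s : Set X} {f : X → E}
    {K : ℝ} (hK : 0 ≤ K) (hf : ∀ x ∈ s, ∀ y ∈ s, dist (f x) (f y) ≤ K * dist x y) :
    ∃ g : X → E, (∀ x y, dist (g x) (g y) ≤ lipschitzExtensionConstant E * K * dist x y) ∧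
      Set.EqOn f g s := by
  have h : LipschitzOnWith K.toNNReal f s :=
    LipschitzOnWith.of_dist_le_mul fun x hx y hy => by
      rw [Real.coe_toNNReal K hK]
      exact hf x hx y hy
  obtain ⟨g, hg, hfg⟩ := h.extend_finite_dimension
  refine ⟨g, fun x y => ?_, hfg⟩
  have := hg.dist_le_mul x y
  rwa [NNReal.coe_mul, Real.coe_toNNReal K hK] at this

/-- A bi-Lipschitz map near `Q` can be localized: there is a globally Lipschitz map supported
near `Q`, still bi-Lipschitz near `Q`, whose first coordinate is a bump function of `Q`. -/
theorem exists_localized_embedding {X E : Type*} [MetricSpace X]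
    [NormedAddCommGroup E] [NormedSpace ℝ E] [FiniteDimensional ℝ E] {Q Z : Set X} {p : X}
    {s η L : ℝ} (hp : p ∈ Q) (hQZ : Q ⊆ Z) (hs : 0 < s) (hη : 0 < η) (hη1 : η ≤ 1)
    (hL : 1 ≤ L) (hdiam : ∀ x ∈ Q, ∀ y ∈ Q, dist x y ≤ s) {h : X → E}
    (hh : BiLipschitzOn h {z | z ∈ Z ∧ Metric.infDist z Q < η * s} L) :
    ∃ u : X → ℝ × E,
      (∀ x y, dist (u x) (u y) ≤
        (1 + lipschitzExtensionConstant E * (L * (4 / η))) * dist x y) ∧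
      (∀ z, ¬ Metric.infDist z Q < η * s → u z = 0) ∧
      (∀ z, ¬ Metric.infDist z Q < η / 2 * s → (u z).1 = 0) ∧
      (∀ z ∈ Q, (u z).1 = η / 2 * s) ∧
      (∀ x ∈ Z, ∀ y ∈ Z, Metric.infDist x Q < η / 2 * s → Metric.infDist y Q < η / 2 * s →
        dist x y ≤ L * dist (u x) (u y)) := by
  classical
  have hne : Q.Nonempty := ⟨p, hp⟩
  have hhalf : η / 2 * s < η * s := by nlinarith
  have hηs : η * s ≤ s := by nlinarith
  have hηs0 : 0 < η * s := by positivity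
  have hp0 : Metric.infDist p Q = 0 := Metric.infDist_zero_of_mem hp
  let N : Set X := {z | Metric.infDist z Q < η * s}
  let N' : Set X := {z | z ∈ Z ∧ Metric.infDist z Q < η / 2 * s}
  let v : X → E := fun z => if z ∈ N then h z - h p else 0
  have hN'N : ∀ z ∈ N', z ∈ N := fun z hz => lt_trans hz.2 hhalf
  have hv1 : ∀ z ∈ N', v z = h z - h p := fun z hz => if_pos (hN'N z hz)
  have hv0 : ∀ z ∉ N, v z = 0 := fun z hz => if_neg hz
  have hLη : L ≤ L * (4 / η) := by
    have : 1 ≤ 4 / η := by rw [le_div_iff₀ hη]; linarith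
    nlinarith
  have hmix : ∀ z ∈ N', ∀ w ∉ N, dist (h z - h p) 0 ≤ L * (4 / η) * dist z w := by
    intro z hz w hw
    obtain ⟨q, hq, hzq⟩ := (Metric.infDist_lt_iff hne).1 (hN'N z hz)
    have h1 : dist z p ≤ 2 * s := by
      linarith [dist_triangle z q p, hdiam q hq p hp]
    have h2 : η / 2 * s ≤ dist z w := by
      have ha := Metric.infDist_le_infDist_add_dist (s := Q) (x := w) (y := z)
      have hb : η * s ≤ Metric.infDist w Q := not_lt.1 hw
      have hc := hz.2
      rw [dist_comm z w]
      linarith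
    have h3 := (hh z ⟨hz.1, hN'N z hz⟩ p ⟨hQZ hp, by rw [hp0]; exact hηs0⟩).2
    rw [dist_zero_right, ← dist_eq_norm]
    refine h3.trans ?_
    rw [mul_assoc]
    refine mul_le_mul_of_nonneg_left ?_ (by linarith)
    rw [div_mul_eq_mul_div, le_div_iff₀ hη]
    nlinarith
  have hvlip : ∀ x ∈ N' ∪ Nᶜ, ∀ y ∈ N' ∪ Nᶜ, dist (v x) (v y) ≤ L * (4 / η) * dist x y := by
    rintro x (hx | hx) y (hy | hy)
    · rw [hv1 x hx, hv1 y hy, dist_sub_right]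
      refine (hh x ⟨hx.1, hN'N x hx⟩ y ⟨hy.1, hN'N y hy⟩).2.trans ?_
      exact mul_le_mul_of_nonneg_right hLη dist_nonneg
    · rw [hv1 x hx, hv0 y hy]
      exact hmix x hx y hy
    · rw [hv0 x hx, hv1 y hy, dist_comm, dist_comm x y]
      exact hmix y hy x hx
    · rw [hv0 x hx, hv0 y hy, dist_self]
      positivity
  obtain ⟨g, hg, hvg⟩ := exists_lipschitz_extension_s1 (by positivity) hvlip
  have hbump : ∀ x y, dist (max 0 (η / 2 * s - Metric.infDist x Q))
      (max 0 (η / 2 * s - Metric.infDist y Q)) ≤ dist x y := by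
    intro x y
    have ha := Metric.infDist_le_infDist_add_dist (s := Q) (x := x) (y := y)
    have hb := Metric.infDist_le_infDist_add_dist (s := Q) (x := y) (y := x)
    rw [dist_comm y x] at hb
    rw [Real.dist_eq, max_comm 0, max_comm 0]
    refine (abs_max_sub_max_le_abs _ _ _).trans ?_
    rw [abs_le]
    constructor <;> linarith
  have hC : 0 ≤ (lipschitzExtensionConstant E : ℝ) * (L * (4 / η)) := by positivity
  refine ⟨fun z => (max 0 (η / 2 * s - Metric.infDist z Q), g z), ?_, ?_, ?_, ?_, ?_⟩
  · intro x y
    have hd : 0 ≤ dist x y := dist_nonneg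
    refine max_le ((hbump x y).trans ?_) ((hg x y).trans ?_)
    · nlinarith
    · nlinarith
  · intro z hz
    refine Prod.ext (max_eq_left ?_) ?_
    · have := not_lt.1 hz
      linarith
    · exact (hvg (Or.inr hz)).symm.trans (hv0 z hz)
  · intro z hz
    have := not_lt.1 hz
    exact max_eq_left (by linarith)
  · intro z hz
    simp only [Metric.infDist_zero_of_mem hz, sub_zero]
    exact max_eq_right (by positivity)
  · intro x hx y hy hxQ hyQ
    have hx' : x ∈ N' := ⟨hx, hxQ⟩
    have hy' : y ∈ N' := ⟨hy, hyQ⟩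
    have hle : dist (h x) (h y) ≤ dist (max 0 (η / 2 * s - Metric.infDist x Q), g x)
        (max 0 (η / 2 * s - Metric.infDist y Q), g y) := by
      refine le_trans (le_of_eq ?_) (le_max_right _ _)
      simp only
      rw [← hvg (Or.inl hx'), ← hvg (Or.inl hy'), hv1 x hx', hv1 y hy', dist_sub_right]
    have hlow := (hh x ⟨hx, hN'N x hx'⟩ y ⟨hy, hN'N y hy'⟩).1
    rw [inv_mul_le_iff₀ (by linarith)] at hlow
    exact hlow.trans (mul_le_mul_of_nonneg_left hle (by linarith))

/-- The metric properties of a family of Whitney cubes `Q i` of the complement of `Y`, with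
centers `p i` and diameters comparable to `s i`. -/
structure WhitneyFamily {X ι : Type*} [MetricSpace X] (Y : Set X) (Q : ι → Set X) (p : ι → X)
    (s : ι → ℝ) (T b : ℝ) : Prop where
  pos : ∀ i, 0 < s i
  center_mem : ∀ i, p i ∈ Q i
  dist_le : ∀ i, ∀ x ∈ Q i, ∀ y ∈ Q i, dist x y ≤ s i
  le_infDist : ∀ i, ∀ x ∈ Q i, s i ≤ Metric.infDist x Y
  infDist_le : ∀ i, ∀ x ∈ Q i, Metric.infDist x Y ≤ T * s i
  ball_subset : ∀ i, Metric.ball (p i) (b * s i) ⊆ Q i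
  disjoint : Pairwise fun i j => Disjoint (Q i) (Q j)

/-- Two cubes are at bounded Whitney distance, quantified by `B`. -/
def WhitneyNear {X ι : Type*} [MetricSpace X] (p : ι → X) (s : ι → ℝ) (B : ℝ) (i j : ι) :
    Prop :=
  s i ≤ B * s j ∧ s j ≤ B * s i ∧ dist (p i) (p j) ≤ B * s i ∧ dist (p i) (p j) ≤ B * s j

theorem WhitneyNear.symm {X ι : Type*} [MetricSpace X] {p : ι → X} {s : ι → ℝ} {B : ℝ}
    {i j : ι} (h : WhitneyNear p s B i j) : WhitneyNear p s B j i := by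
  unfold WhitneyNear at *
  rw [dist_comm]
  tauto

namespace WhitneyFamily

variable {X ι : Type*} [MetricSpace X] {Y : Set X} {Q : ι → Set X} {p : ι → X} {s : ι → ℝ}
  {T b : ℝ}

theorem bounds_of_infDist_lt (W : WhitneyFamily Y Q p s T b) {η : ℝ} (hη : η ≤ 1 / 2) {i : ι}
    {z : X} (hz : Metric.infDist z (Q i) < η * s i) :
    s i ≤ 2 * Metric.infDist z Y ∧ Metric.infDist z Y ≤ (T + 1) * s i ∧
      dist z (p i) ≤ 2 * s i := by
  obtain ⟨q, hq, hzq⟩ := (Metric.infDist_lt_iff ⟨_, W.center_mem i⟩).1 hz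
  have hs := W.pos i
  have h0 : dist z q ≤ s i / 2 := by nlinarith
  have h1 := W.le_infDist i q hq
  have h2 := W.infDist_le i q hq
  have h3 := Metric.infDist_le_infDist_add_dist (s := Y) (x := z) (y := q)
  have h4 := Metric.infDist_le_infDist_add_dist (s := Y) (x := q) (y := z)
  rw [dist_comm q z] at h4
  refine ⟨by linarith, by linarith, ?_⟩
  linarith [dist_triangle z q (p i), W.dist_le i q hq _ (W.center_mem i)]

theorem card_le_of_near [MeasurableSpace X] [BorelSpace X] {μ : MeasureTheory.Measure X}
    {D : ℝ} (hD : 1 ≤ D) (hμ : IsDoublingMeasure μ D) (W : WhitneyFamily Y Q p s T b)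
    (hb : 0 < b) {B : ℝ} (hB : 1 ≤ B) {m n : ℕ} (hm : 2 * (B + b) * B ≤ 2 ^ m * b)
    (hn : D ^ m ≤ n) (i : ι) (t : Finset ι) (ht : ∀ j ∈ t, WhitneyNear p s B i j) :
    t.card ≤ n := by
  have hs := W.pos i
  have hB0 : 0 < B := by linarith
  refine hμ.card_le_of_disjoint hD (x₀ := p i) (p := p) (ρ := b * s i / B)
    (σ := (B + b) * s i) (m := m) (by positivity) t ?_ ?_ ?_ hn
  · intro j hj k hk hjk
    have hsub : ∀ l ∈ t, Metric.ball (p l) (b * s i / B) ⊆ Q l := by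
      intro l hl
      refine (Metric.ball_subset_ball ?_).trans (W.ball_subset l)
      rw [div_le_iff₀ hB0]
      nlinarith [(ht l hl).1]
    exact (W.disjoint hjk).mono (hsub j hj) (hsub k hk)
  · intro j hj
    have h1 := (ht j hj).2.2.1
    have h2 : b * s i / B ≤ b * s i := div_le_self (by positivity) hB
    linarith
  · rw [mul_div_assoc', le_div_iff₀ hB0]
    nlinarith


theorem near_of_infDist_lt (W : WhitneyFamily Y Q p s T b) (hT : 1 ≤ T) {η B : ℝ}
    (hη : η ≤ 1 / 2) (hB : 2 + 4 * (T + 1) ≤ B) {i j : ι} {z : X}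
    (hi : Metric.infDist z (Q i) < η * s i) (hj : Metric.infDist z (Q j) < η * s j) :
    WhitneyNear p s B i j := by
  obtain ⟨a1, a2, a3⟩ := W.bounds_of_infDist_lt hη hi
  obtain ⟨b1, b2, b3⟩ := W.bounds_of_infDist_lt hη hj
  have hsi := W.pos i
  have hsj := W.pos j
  have h3 : dist (p i) (p j) ≤ 2 * s i + 2 * s j := by
    have := dist_triangle (p i) z (p j)
    rw [dist_comm (p i) z] at this
    linarith
  have h4 : (2 + 4 * (T + 1)) * s i ≤ B * s i := mul_le_mul_of_nonneg_right hB hsi.le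
  have h5 : (2 + 4 * (T + 1)) * s j ≤ B * s j := mul_le_mul_of_nonneg_right hB hsj.le
  have hTi : 0 ≤ T * s i := by positivity
  have hTj : 0 ≤ T * s j := by positivity
  exact ⟨by linarith, by linarith, by linarith, by linarith⟩

theorem near_of_dist_lt (W : WhitneyFamily Y Q p s T b) (hT : 1 ≤ T) {η Λ B : ℝ}
    (hη : η ≤ 1 / 2) (hΛ : 0 ≤ Λ) (hB : (4 + Λ * T + 4 * T) * (2 * (T + 1)) ≤ B)
    {i j : ι} {x y : X} (hi : x ∈ Q i) (hj : Metric.infDist y (Q j) < η * s j)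
    (hyx : Metric.infDist y Y ≤ Metric.infDist x Y)
    (hxy : Metric.infDist x Y < 2 * Metric.infDist y Y)
    (hd : dist x y ≤ Λ * Metric.infDist x Y) :
    WhitneyNear p s B i j := by
  obtain ⟨b1, b2, b3⟩ := W.bounds_of_infDist_lt hη hj
  have hsi := W.pos i
  have hsj := W.pos j
  have hxs := W.infDist_le i x hi
  have hsx := W.le_infDist i x hi
  have hΛT : 0 ≤ Λ * T := by positivity
  have g1 : s j ≤ 2 * T * s i := by linarith
  have g2 : s i ≤ 2 * (T + 1) * s j := by linarith
  have g0 : dist x y ≤ Λ * T * s i := by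
    rw [mul_assoc]
    exact hd.trans (mul_le_mul_of_nonneg_left hxs hΛ)
  have g3 : dist (p i) (p j) ≤ s i + Λ * T * s i + 2 * s j := by
    have := dist_triangle4 (p i) x y (p j)
    linarith [W.dist_le i _ (W.center_mem i) x hi]
  have g4 : dist (p i) (p j) ≤ (1 + Λ * T + 4 * T) * s i := by linarith
  have hB3 : (1 + Λ * T + 4 * T) * (2 * (T + 1)) ≤ B := by nlinarith
  have hB1 : 1 + Λ * T + 4 * T ≤ B := by nlinarith
  have hB2 : 2 * (T + 1) ≤ B := by nlinarith
  refine ⟨?_, ?_, ?_, ?_⟩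
  · exact g2.trans (mul_le_mul_of_nonneg_right hB2 hsj.le)
  · exact g1.trans (mul_le_mul_of_nonneg_right (by linarith) hsi.le)
  · exact g4.trans (mul_le_mul_of_nonneg_right hB1 hsi.le)
  · calc dist (p i) (p j) ≤ (1 + Λ * T + 4 * T) * s i := g4
      _ ≤ (1 + Λ * T + 4 * T) * (2 * (T + 1) * s j) :=
        mul_le_mul_of_nonneg_left g2 (by linarith)
      _ = (1 + Λ * T + 4 * T) * (2 * (T + 1)) * s j := by ring
      _ ≤ B * s j := mul_le_mul_of_nonneg_right hB3 hsj.le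

/-- An embedding of `Y`, the distance to `Y`, and coloured local embeddings of the Whitney
cubes combine to an embedding of the union of the cubes and `Y`. -/
theorem exists_embedding (W : WhitneyFamily Y Q p s T b) {E₁ E₂ : Type*}
    [NormedAddCommGroup E₁] [NormedSpace ℝ E₁] [FiniteDimensional ℝ E₁]
    [NormedAddCommGroup E₂] [NormedSpace ℝ E₂] [FiniteDimensional ℝ E₂]
    (hT : 1 ≤ T) (hYne : Y.Nonempty) {η L₁ L₂ Λ B : ℝ} (hη : 0 < η)
    (hη2 : η ≤ 1 / 2) (hL₁ : 1 ≤ L₁) (hL₂ : 1 ≤ L₂) {f : X → E₁} (hf : BiLipschitzOn f Y L₁)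
    (hloc : ∀ i, ∃ h : X → E₂, BiLipschitzOn h
      {z | z ∈ (⋃ i, Q i) ∪ Y ∧ Metric.infDist z (Q i) < η * s i} L₂)
    (hΛ : 8 * (1 + lipschitzExtensionConstant E₁ * L₁ * L₁) ≤ Λ)
    (hB : (4 + Λ * T + 4 * T) * (2 * (T + 1)) ≤ B) {n : ℕ} (c : ι → Fin n)
    (hc : ∀ i j, i ≠ j → WhitneyNear p s B i j → c i ≠ c j) :
    ∃ G : X → E₁ × ℝ × (Fin n → ℝ × E₂),
      ∀ x ∈ (⋃ i, Q i) ∪ Y, ∀ y ∈ (⋃ i, Q i) ∪ Y,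
        dist (G x) (G y) ≤ (lipschitzExtensionConstant E₁ * L₁ + 1 +
          2 * (1 + lipschitzExtensionConstant E₂ * (L₂ * (4 / η)))) * dist x y ∧
        dist x y ≤ (2 * L₁ + 2 * Λ + L₂ + 2 * Λ * T / η) * dist (G x) (G y) := by
  set Z := (⋃ i, Q i) ∪ Y
  have hQZ : ∀ i, Q i ⊆ Z := fun i z hz => Or.inl (Set.mem_iUnion.2 ⟨i, hz⟩)
  set K₁ : ℝ := lipschitzExtensionConstant E₁ * L₁
  set K₃ : ℝ := 1 + lipschitzExtensionConstant E₂ * (L₂ * (4 / η))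
  have hK₁0 : 0 ≤ K₁ := by positivity
  have hK₃0 : 0 ≤ K₃ := by positivity
  have hΛ8 : 8 ≤ Λ := by nlinarith [mul_nonneg hK₁0 (by linarith : (0:ℝ) ≤ L₁)]
  have hΛT : 8 ≤ Λ * T := by nlinarith
  obtain ⟨φ, hφ, hfφ⟩ := exists_lipschitz_extension_s1 (by linarith : 0 ≤ L₁)
    fun x hx y hy => (hf x hx y hy).2
  have hu : ∀ i, ∃ u : X → ℝ × E₂, _ := fun i => by
    obtain ⟨h, hh⟩ := hloc i
    exact exists_localized_embedding (W.center_mem i) (hQZ i) (W.pos i) hη (by linarith) hL₂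
      (W.dist_le i) hh
  choose u hu1 hu2 hu3 hu4 hu5 using hu
  have hsep : ∀ z i j, Metric.infDist z (Q i) < η * s i → Metric.infDist z (Q j) < η * s j →
      c i = c j → i = j := by
    intro z i j hi hj hcij
    by_contra hne
    refine hc i j hne ?_ hcij
    exact W.near_of_infDist_lt hT hη2 (by nlinarith) hi hj
  have hglue : ∀ k : Fin n, ∃ U : X → ℝ × E₂, _ := fun k =>
    exists_lipschitz_glue (ι := {i // c i = k}) (fun i => u i)
      (fun i => {z | Metric.infDist z (Q i) < η * s i}) K₃
      (fun z i j hi hj => Subtype.ext (hsep z i j hi hj (i.2.trans j.2.symm)))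
      (fun i => hu2 i) (fun i => hu1 i) hK₃0
  choose U hU1 hU2 hU3 using hglue
  let G : X → E₁ × ℝ × (Fin n → ℝ × E₂) := fun x => (φ x, Metric.infDist x Y, fun k => U k x)
  have hG1 : ∀ x y, dist (φ x) (φ y) ≤ dist (G x) (G y) := fun x y => le_max_left _ _
  have hG2 : ∀ x y, Metric.infDist x Y - Metric.infDist y Y ≤ dist (G x) (G y) := fun x y =>
    (le_abs_self _).trans ((le_max_left _ _).trans (le_max_right _ _))
  have hG3 : ∀ x y k, dist (U k x) (U k y) ≤ dist (G x) (G y) := fun x y k =>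
    (dist_le_pi_dist (fun k => U k x) (fun k => U k y) k).trans
      ((le_max_right _ _).trans (le_max_right _ _))
  have hlow : ∀ x ∈ Z, ∀ y ∈ Z, Metric.infDist y Y ≤ Metric.infDist x Y →
      dist x y ≤ (2 * L₁ + 2 * Λ + L₂ + 2 * Λ * T / η) * dist (G x) (G y) := by
    intro x hx y hy hyx
    have hG0 : 0 ≤ dist (G x) (G y) := dist_nonneg
    have hc4 : 0 ≤ 2 * Λ * T / η * dist (G x) (G y) := by positivity
    have hc3 : 0 ≤ L₂ * dist (G x) (G y) := by positivity
    have hc2 : 0 ≤ 2 * Λ * dist (G x) (G y) := by positivity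
    have hc1 : 0 ≤ 2 * L₁ * dist (G x) (G y) := by positivity
    rcases (dist_nonneg (x := x) (y := y)).eq_or_lt with hd0 | hd
    · rw [← hd0]
      linarith
    rcases le_or_gt (Λ * Metric.infDist x Y) (dist x y) with hfar | hnear
    · have happrox : ∀ w, Metric.infDist w Y ≤ Metric.infDist x Y →
          ∃ w' ∈ Y, Λ * dist w w' ≤ 2 * dist x y := by
        intro w hw
        have : Metric.infDist w Y < 2 * dist x y / Λ := by
          rw [lt_div_iff₀ (by linarith)]
          nlinarith
        obtain ⟨w', hw', hlt⟩ := (Metric.infDist_lt_iff hYne).1 this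
        rw [lt_div_iff₀ (by linarith)] at hlt
        exact ⟨w', hw', by linarith⟩
      obtain ⟨x', hx', hxx'⟩ := happrox x le_rfl
      obtain ⟨y', hy', hyy'⟩ := happrox y hyx
      have h1 := (hf x' hx' y' hy').1
      rw [inv_mul_le_iff₀ (by linarith), hfφ hx', hfφ hy'] at h1
      have h2 : dist (φ x') (φ y') ≤ K₁ * dist x x' + dist (φ x) (φ y) + K₁ * dist y y' := by
        have := dist_triangle4 (φ x') (φ x) (φ y) (φ y')
        rw [dist_comm (φ x') (φ x)] at this
        linarith [hφ x x', hφ y y']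
      have h3 : dist x y ≤ dist x x' + dist x' y' + dist y y' := by
        have := dist_triangle4 x x' y' y
        rwa [dist_comm y' y] at this
      have h4 : dist x y ≤ (1 + K₁ * L₁) * (dist x x' + dist y y') + L₁ * dist (φ x) (φ y) := by
        nlinarith
      have h5 : (1 + K₁ * L₁) * (dist x x' + dist y y') ≤
          Λ / 8 * (dist x x' + dist y y') :=
        mul_le_mul_of_nonneg_right (by linarith) (by positivity)
      have h6 : dist x y ≤ 2 * L₁ * dist (φ x) (φ y) := by linarith
      have h7 : 2 * L₁ * dist (φ x) (φ y) ≤ 2 * L₁ * dist (G x) (G y) :=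
        mul_le_mul_of_nonneg_left (hG1 x y) (by linarith)
      linarith
    rcases le_or_gt (2 * Metric.infDist y Y) (Metric.infDist x Y) with hdrop | hcomp
    · have h1 : 2 * Λ * (Metric.infDist x Y - Metric.infDist y Y) ≤
          2 * Λ * dist (G x) (G y) := mul_le_mul_of_nonneg_left (hG2 x y) (by linarith)
      nlinarith
    have hxY : x ∉ Y := by
      intro h
      rw [Metric.infDist_zero_of_mem h] at hnear
      linarith
    obtain ⟨i, hi⟩ := Set.mem_iUnion.1 (hx.resolve_right hxY)
    have hsi := W.pos i
    have hx0 : Metric.infDist x (Q i) = 0 := Metric.infDist_zero_of_mem hi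
    have hxi : Metric.infDist x (Q i) < η * s i := by rw [hx0]; positivity
    have hUx : U (c i) x = u i x := hU2 (c i) ⟨i, rfl⟩ x hxi
    have hxs := W.infDist_le i x hi
    have hsx := W.le_infDist i x hi
    by_cases hyi : Metric.infDist y (Q i) < η / 2 * s i
    · have hUy : U (c i) y = u i y := hU2 (c i) ⟨i, rfl⟩ y (by
        change Metric.infDist y (Q i) < η * s i
        nlinarith)
      have h1 := hu5 i x hx y hy (by rw [hx0]; positivity) hyi
      have h2 := hG3 x y (c i)
      rw [hUx, hUy] at h2
      have h3 := mul_le_mul_of_nonneg_left h2 (by linarith : 0 ≤ L₂)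
      linarith
    · have hdist : dist x y ≤ Λ * T * s i := by nlinarith
      have hUy : (U (c i) y).1 = 0 := by
        by_cases hex : ∃ j : {j // c j = c i}, Metric.infDist y (Q j) < η * s j
        · obtain ⟨j, hj⟩ := hex
          have hji : (j : ι) = i := by
            by_contra hne
            refine hc i j (Ne.symm hne) ?_ j.2.symm
            exact W.near_of_dist_lt hT hη2 (by linarith) hB hi hj hyx hcomp hnear.le
          rw [hU2 (c i) j y hj, hji]
          exact hu3 i y hyi
        · rw [hU3 (c i) y (fun j hj => hex ⟨j, hj⟩)]
          rfl
      have h1 : η / 2 * s i ≤ dist (G x) (G y) := by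
        refine le_trans ?_ (hG3 x y (c i))
        refine le_trans ?_ (le_max_left _ _)
        rw [hUx, hUy, hu4 i x hi, Real.dist_eq, sub_zero]
        exact le_abs_self _
      have h2 : Λ * T * s i = 2 * Λ * T / η * (η / 2 * s i) := by
        field_simp
      have h3 := mul_le_mul_of_nonneg_left h1 (by positivity : 0 ≤ 2 * Λ * T / η)
      linarith
  refine ⟨G, fun x hx y hy => ⟨?_, ?_⟩⟩
  · have hd : 0 ≤ dist x y := dist_nonneg
    have hd1 : 0 ≤ K₁ * dist x y := by positivity
    have hd3 : 0 ≤ 2 * K₃ * dist x y := by positivity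
    refine max_le ((hφ x y).trans (by linarith)) (max_le ?_ ?_)
    · have := (Metric.lipschitz_infDist_pt Y).dist_le_mul x y
      rw [NNReal.coe_one, one_mul] at this
      exact this.trans (by linarith)
    · rw [dist_pi_le_iff (by positivity)]
      intro k
      exact (hU1 k x y).trans (by linarith)
  · rcases le_total (Metric.infDist y Y) (Metric.infDist x Y) with h | h
    · exact hlow x hx y hy h
    · rw [dist_comm x y, dist_comm (G x)]
      exact hlow y hy x hx h

end WhitneyFamily

namespace ChristWhitney

variable {X : Type*} [MetricSpace X] [MeasurableSpace X] {μ : MeasureTheory.Measure X}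
  {Y : Set X} {A δ a₀ C₁ : ℝ} {M : Set (Set X)}

theorem isBounded (hM : ChristWhitney μ Y A δ a₀ C₁ M) {Q : Set X} (hQ : Q ∈ M) :
    Bornology.IsBounded Q := by
  obtain ⟨x, -, k, -, h⟩ := hM.quasiball Q hQ
  exact Metric.isBounded_ball.subset h

theorem diam_pos (hM : ChristWhitney μ Y A δ a₀ C₁ M) (hA : 1 ≤ A) (hδ : 0 < δ) (ha₀ : 0 < a₀)
    (hX : UniformlyPerfect X A) (hY : Y.Nonempty) {Q : Set X} (hQ : Q ∈ M) :
    0 < Metric.diam Q := by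
  obtain ⟨x, -, k, hin, -⟩ := hM.quasiball Q hQ
  have hr : 0 < a₀ * δ ^ k := by positivity
  have hlt : ENNReal.ofReal (a₀ * δ ^ k / 2) < Metric.ediam (Set.univ : Set X) := by
    by_contra! hle
    obtain ⟨y, hy⟩ := hY
    have h1 := (Metric.edist_le_ediam_of_mem (Set.mem_univ x) (Set.mem_univ y)).trans hle
    rw [edist_dist, ENNReal.ofReal_le_ofReal_iff (by positivity)] at h1
    refine hM.subset_compl Q hQ (hin ?_) hy
    rw [Metric.mem_ball, dist_comm]
    linarith
  obtain ⟨y, hy1, hy2⟩ := hX x _ (half_pos hr) hlt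
  have hyQ : y ∈ Q := hin (by rw [Metric.mem_ball, dist_comm]; linarith)
  have h2 := Metric.dist_le_diam_of_mem (hM.isBounded hQ) (hin (Metric.mem_ball_self hr)) hyQ
  have h3 : 0 < A⁻¹ * (a₀ * δ ^ k / 2) := by positivity
  linarith

theorem exists_whitneyFamily (hM : ChristWhitney μ Y A δ a₀ C₁ M) (hA : 1 ≤ A) (hδ : 0 < δ)
    (ha₀ : 0 < a₀) (hC₁ : 0 < C₁) (hX : UniformlyPerfect X A) (hY : Y.Nonempty) :
    ∃ p : M → X, WhitneyFamily Y (fun Q : M => (Q : Set X)) p (fun Q => Metric.diam (Q : Set X))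
      (4 * C₁ * A / δ + 1) (a₀ / (2 * C₁)) := by
  have hq : ∀ Q : M, ∃ x, x ∈ (Q : Set X) ∧
      Metric.ball x (a₀ / (2 * C₁) * Metric.diam (Q : Set X)) ⊆ Q := by
    intro Q
    obtain ⟨x, -, k, hin, hout⟩ := hM.quasiball Q Q.2
    have hδk : 0 < δ ^ k := by positivity
    refine ⟨x, hin (Metric.mem_ball_self (by positivity)), (Metric.ball_subset_ball ?_).trans hin⟩
    have h1 : Metric.diam (Q : Set X) ≤ 2 * (C₁ * δ ^ k) :=
      (Metric.diam_mono hout Metric.isBounded_ball).trans (Metric.diam_ball (by positivity))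
    calc a₀ / (2 * C₁) * Metric.diam (Q : Set X) ≤ a₀ / (2 * C₁) * (2 * (C₁ * δ ^ k)) := by gcongr
      _ = a₀ * δ ^ k := by field_simp
  choose p hp hball using hq
  refine ⟨p, fun Q => hM.diam_pos hA hδ ha₀ hX hY Q.2, hp,
    fun Q x hx y hy => Metric.dist_le_diam_of_mem (hM.isBounded Q.2) hx hy, ?_, ?_, hball, ?_⟩
  · intro Q x hx
    rw [Metric.le_infDist hY]
    intro y hy
    exact (hM.diam_le_dist Q Q.2).trans (setDist_le_dist hx hy)
  · intro Q x hx
    refine le_of_forall_pos_lt_add fun r hr => ?_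
    have h1 : setDist (Q : Set X) Y < 4 * C₁ * A / δ * Metric.diam (Q : Set X) + r := by
      linarith [hM.dist_le_diam Q Q.2]
    obtain ⟨_, ⟨q, hq, y, hy, rfl⟩, hlt⟩ :=
      exists_lt_of_csInf_lt (Set.Nonempty.image2 ⟨x, hx⟩ hY) h1
    have h2 := Metric.infDist_le_dist_of_mem (x := x) hy
    have h3 := Metric.dist_le_diam_of_mem (hM.isBounded Q.2) hx hq
    linarith [dist_triangle x q y]
  · intro Q R hQR
    exact hM.pairwiseDisjoint Q.2 R.2 fun h => hQR (Subtype.ext h)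

end ChristWhitney

theorem WhitneyFamily.subset_dstar2Q {X : Type*} [MetricSpace X] {Y : Set X} {M : Set (Set X)}
    {p : M → X} {T b ε : ℝ}
    (W : WhitneyFamily Y (fun Q : M => (Q : Set X)) p (fun Q => Metric.diam (Q : Set X)) T b)
    (hT : 1 ≤ T) (hε : 0 < ε) (hε1 : ε ≤ 1) (Q : M) :
    {z | z ∈ (⋃ R : M, (R : Set X)) ∪ Y ∧
      Metric.infDist z (Q : Set X) < ε / (2 * T) * Metric.diam (Q : Set X)} ⊆
      dstar2Q ε M Q := by
  rintro z ⟨hz, hzQ⟩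
  have hη : ε / (2 * T) ≤ 1 / 2 := by
    rw [div_le_iff₀ (by positivity)]
    linarith
  obtain ⟨h1, -, -⟩ := W.bounds_of_infDist_lt hη hzQ
  have hQ := W.pos Q
  rcases hz with hz | hz
  swap
  · rw [Metric.infDist_zero_of_mem hz] at h1
    linarith
  obtain ⟨R, hR⟩ := Set.mem_iUnion.1 hz
  have h2 := W.infDist_le R z hR
  have hRpos := W.pos R
  obtain ⟨q, hq, hzq⟩ := (Metric.infDist_lt_iff ⟨_, W.center_mem Q⟩).1 hzQ
  have h3 : ε / (2 * T) * Metric.diam (Q : Set X) ≤ ε * Metric.diam (Q : Set X) := by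
    gcongr
    exact div_le_self hε.le (by linarith)
  have h4 : ε / (2 * T) * Metric.diam (Q : Set X) ≤ ε * Metric.diam (R : Set X) := by
    rw [div_mul_eq_mul_div, div_le_iff₀ (by positivity), mul_assoc]
    exact mul_le_mul_of_nonneg_left (by linarith) hε.le
  refine Set.mem_biUnion (x := (R : Set X)) ⟨R.2, R, ⟨R.2, ?_⟩, ?_⟩ hR
  · rw [mul_min_of_nonneg _ _ hε.le]
    refine (setDist_le_dist hq hR).trans_lt ?_
    rw [dist_comm]
    exact hzq.trans_le (le_min h3 h4)
  · rw [min_self]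
    refine (setDist_le_dist (W.center_mem R) (W.center_mem R)).trans_lt ?_
    rw [dist_self]
    positivity

/-- Under the hypotheses of the main theorem, the full-measure set
`(⋃_{Q ∈ M} Q) ∪ Y` admits a bi-Lipschitz embedding into some Euclidean space, with
constant and dimension depending only on the data. -/
theorem statement1 (A D δ a₀ C₁ ε L₁ L₂ : ℝ) (M₁ M₂ : ℕ)
    (hA : 1 ≤ A) (hD : 1 ≤ D) (hδ : δ ∈ Set.Ioo (0:ℝ) 1)
    (ha₀ : a₀ ∈ Set.Ioo (0:ℝ) 1) (hC₁ : 0 < C₁) (hε : ε ∈ Set.Ioo (0:ℝ) 1)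
    (hL₁ : 1 ≤ L₁) (hL₂ : 1 ≤ L₂) :
    ∃ (n : ℕ) (L : ℝ), 1 ≤ L ∧
      ∀ (X : Type) [MetricSpace X] [CompleteSpace X] [MeasurableSpace X]
        [BorelSpace X] (μ : MeasureTheory.Measure X) (Y : Set X)
        (M : Set (Set X)),
        UniformlyPerfect X A →
        IsDoublingMeasure μ D →
        Y.Nonempty → IsClosed Y →
        ChristWhitney μ Y A δ a₀ C₁ M →
        (∃ f : X → EuclideanSpace ℝ (Fin M₁), BiLipschitzOn f Y L₁) →
        (∀ Q ∈ M, ∃ h : X → EuclideanSpace ℝ (Fin M₂),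
          BiLipschitzOn h (dstar2Q ε M Q) L₂) →
        ∃ F : X → EuclideanSpace ℝ (Fin n),
          BiLipschitzOn F ((⋃ Q ∈ M, Q) ∪ Y) L := by
  obtain ⟨hδ0, -⟩ := hδ
  obtain ⟨ha0, -⟩ := ha₀
  obtain ⟨hε0, hε1⟩ := hε
  set T : ℝ := 4 * C₁ * A / δ + 1
  have hT : 1 ≤ T := by
    have : 0 ≤ 4 * C₁ * A / δ := by positivity
    linarith
  set b : ℝ := a₀ / (2 * C₁)
  have hb : 0 < b := by positivity
  set η : ℝ := ε / (2 * T)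
  have hη : 0 < η := by positivity
  have hη2 : η ≤ 1 / 2 := by
    rw [div_le_iff₀ (by positivity)]
    linarith
  set Λ : ℝ := 8 * (1 + lipschitzExtensionConstant (EuclideanSpace ℝ (Fin M₁)) * L₁ * L₁)
  have hΛ : 0 ≤ Λ := by positivity
  set B : ℝ := (4 + Λ * T + 4 * T) * (2 * (T + 1))
  have hB : 1 ≤ B := by
    have : 0 ≤ Λ * T := by positivity
    nlinarith
  obtain ⟨m, hm⟩ := pow_unbounded_of_one_lt (2 * (B + b) * B / b) (one_lt_two : (1 : ℝ) < 2)
  rw [div_lt_iff₀ hb] at hm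
  obtain ⟨N, hN⟩ := exists_nat_ge (D ^ m)
  let V := EuclideanSpace ℝ (Fin M₁) × ℝ × (Fin (N + 1) → ℝ × EuclideanSpace ℝ (Fin M₂))
  let e : V ≃L[ℝ] EuclideanSpace ℝ (Fin (Module.finrank ℝ V)) :=
    ContinuousLinearEquiv.ofFinrankEq (by simp)
  set Cu : ℝ := lipschitzExtensionConstant (EuclideanSpace ℝ (Fin M₁)) * L₁ + 1 +
    2 * (1 + lipschitzExtensionConstant (EuclideanSpace ℝ (Fin M₂)) * (L₂ * (4 / η)))
  set Cl : ℝ := 2 * L₁ + 2 * Λ + L₂ + 2 * Λ * T / η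
  have hCu : 0 ≤ Cu := by positivity
  have hCl : 0 ≤ Cl := by positivity
  set a := ‖(e : V →L[ℝ] EuclideanSpace ℝ (Fin (Module.finrank ℝ V)))‖
  set a' := ‖(e.symm : EuclideanSpace ℝ (Fin (Module.finrank ℝ V)) →L[ℝ] V)‖
  have haCu : 0 ≤ a * Cu := by positivity
  have haCl : 0 ≤ Cl * a' := by positivity
  refine ⟨Module.finrank ℝ V, 1 + a * Cu + Cl * a', by linarith, ?_⟩
  intro X _ _ _ _ μ Y M hX hμ hYne _ hM ⟨f, hf⟩ hloc
  obtain ⟨p, W⟩ := hM.exists_whitneyFamily hA hδ0 ha0 hC₁ hX hYne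
  have : Countable M := hM.countable.to_subtype
  obtain ⟨c, hc⟩ := exists_coloring_of_degree_le (WhitneyNear p (fun Q : M => Metric.diam Q.1) B)
    (fun i j h => h.symm) N fun i t ht => W.card_le_of_near hD hμ hb hB hm.le hN i t ht
  rw [Set.biUnion_eq_iUnion]
  obtain ⟨G, hG⟩ := W.exists_embedding hT hYne hη hη2 hL₁ hL₂ hf
    (fun i => by
      obtain ⟨h, hh⟩ := hloc i i.2
      have hsub := W.subset_dstar2Q hT hε0 hε1.le i
      exact ⟨h, fun x hx y hy => hh x (hsub hx) y (hsub hy)⟩) le_rfl le_rfl c hc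
  refine ⟨fun x => e (G x), fun x hx y hy => ?_⟩
  obtain ⟨hup, hlow⟩ := hG x hx y hy
  have hd : 0 ≤ dist x y := dist_nonneg
  have hd' : 0 ≤ dist (e (G x)) (e (G y)) := dist_nonneg
  have h1 : dist (e (G x)) (e (G y)) ≤ a * dist (G x) (G y) :=
    e.lipschitz.dist_le_mul (G x) (G y)
  have h2 : dist (G x) (G y) ≤ a' * dist (e (G x)) (e (G y)) := by
    have := e.symm.lipschitz.dist_le_mul (e (G x)) (e (G y))
    rwa [e.symm_apply_apply, e.symm_apply_apply] at this
  constructor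
  · rw [inv_mul_le_iff₀ (by linarith)]
    calc dist x y ≤ Cl * dist (G x) (G y) := hlow
      _ ≤ Cl * (a' * dist (e (G x)) (e (G y))) := mul_le_mul_of_nonneg_left h2 hCl
      _ = Cl * a' * dist (e (G x)) (e (G y)) := by ring
      _ ≤ _ := mul_le_mul_of_nonneg_right (by linarith) hd'
  · calc dist (e (G x)) (e (G y)) ≤ a * dist (G x) (G y) := h1
      _ ≤ a * (Cu * dist x y) := mul_le_mul_of_nonneg_left hup (norm_nonneg _)
      _ = a * Cu * dist x y := by ring
      _ ≤ _ := mul_le_mul_of_nonneg_right (by linarith) hd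
end

section
/- Let (X,d) be a metric space, Y ⊆ X a nonempty subset, and Λ > 0. Let Q and R be nonempty bounded subsets of X satisfying diam(Q) ≤ dist(Q,Y) ≤ Λ·diam(Q) and diam(R) ≤ dist(R,Y) ≤ Λ·diam(R). If ε ∈ (0,1) and dist(Q,R) < ε·min(diam Q, diam R), then (Λ + 1 + ε)⁻¹·diam(R) ≤ diam(Q) ≤ (Λ + 1 + ε)·diam(R). (In the paper Λ = 4C₁A/δ, so that R belongs to star(Q).) -/
theorem setDist_comm {X : Type*} [MetricSpace X] (s t : Set X) :
    setDist s t = setDist t s := by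
  unfold setDist
  rw [Set.image2_swap]
  simp only [dist_comm]

theorem exists_dist_lt_of_setDist_lt {X : Type*} [MetricSpace X] {s t : Set X} {r : ℝ}
    (hs : s.Nonempty) (ht : t.Nonempty) (h : setDist s t < r) :
    ∃ x ∈ s, ∃ y ∈ t, dist x y < r := by
  obtain ⟨_, ⟨x, hx, y, hy, rfl⟩, hxy⟩ := exists_lt_of_csInf_lt (hs.image2 ht) h
  exact ⟨x, hx, y, hy, hxy⟩

/-- The triangle inequality for distances between sets, with the diameter of the
intermediate set as an error term. -/
theorem setDist_le_add_diam_add {X : Type*} [MetricSpace X] {s t u : Set X}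
    (hs : s.Nonempty) (ht : t.Nonempty) (hu : u.Nonempty) (htb : Bornology.IsBounded t) :
    setDist s u ≤ setDist s t + Metric.diam t + setDist t u := by
  refine le_of_forall_pos_le_add fun η hη => ?_
  obtain ⟨x, hx, y, hy, hxy⟩ :=
    exists_dist_lt_of_setDist_lt hs ht (lt_add_of_pos_right (setDist s t) (half_pos hη))
  obtain ⟨z, hz, w, hw, hzw⟩ :=
    exists_dist_lt_of_setDist_lt ht hu (lt_add_of_pos_right (setDist t u) (half_pos hη))
  have hxw := setDist_le_dist hx hw
  have htri := dist_triangle4 x y z w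
  have hyz := Metric.dist_le_diam_of_mem htb hy hz
  linarith

/-- (Comparability of neighbouring Whitney cubes.) If `Q` and `R` satisfy
the Whitney comparability condition relative to `Y` with constant `Λ` and
`dist(Q,R) < ε min(diam Q, diam R)`, then `diam Q` and `diam R` are
`(Λ + 1 + ε)`-comparable. -/
theorem statement3 {X : Type*} [MetricSpace X] (Y Q R : Set X) (Λ ε : ℝ)
    (hΛ : 0 < Λ) (hY : Y.Nonempty)
    (hQne : Q.Nonempty) (hRne : R.Nonempty)
    (hQb : Bornology.IsBounded Q) (hRb : Bornology.IsBounded R)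
    (hQ1 : Metric.diam Q ≤ setDist Q Y) (hQ2 : setDist Q Y ≤ Λ * Metric.diam Q)
    (hR1 : Metric.diam R ≤ setDist R Y) (hR2 : setDist R Y ≤ Λ * Metric.diam R)
    (hε : ε ∈ Set.Ioo (0:ℝ) 1)
    (hd : setDist Q R < ε * min (Metric.diam Q) (Metric.diam R)) :
    (Λ + 1 + ε)⁻¹ * Metric.diam R ≤ Metric.diam Q ∧
      Metric.diam Q ≤ (Λ + 1 + ε) * Metric.diam R := by
  have hQR := setDist_le_add_diam_add hQne hRne hY hRb
  have hRQ := setDist_le_add_diam_add hRne hQne hY hQb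
  rw [setDist_comm R Q] at hRQ
  have hminQ := mul_le_mul_of_nonneg_left
    (min_le_left (Metric.diam Q) (Metric.diam R)) hε.1.le
  have hminR := mul_le_mul_of_nonneg_left
    (min_le_right (Metric.diam Q) (Metric.diam R)) hε.1.le
  have hpos : 0 < Λ + 1 + ε := by linarith [hε.1]
  constructor
  · rw [inv_mul_le_iff₀ hpos]
    linarith
  · linarith
end

section
/- Let (X,d) be a metric space, Y ⊆ X nonempty, and let M be a family of nonempty bounded subsets of X ∖ Y with diam(Q) ≤ dist(Q,Y) ≤ Λ·diam(Q) for every Q ∈ M, where Λ > 0. Let T ≥ 1 (in the paper T = 16·M₁·L₁²). Then there exists c > 0, depending only on T and Λ, such that for all Q, R ∈ M with d_W(Q,R) ≥ T and dist(Q,R) ≤ (T/(2(1+Λ)))·max(diam Q, diam R), and all p ∈ Q, q ∈ R, one has |dist(p,Y) − dist(q,Y)| ≥ c·d(p,q). -/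
theorem le_setDist {X : Type*} [MetricSpace X] {s t : Set X} {r : ℝ}
    (hs : s.Nonempty) (ht : t.Nonempty) (h : ∀ x ∈ s, ∀ y ∈ t, r ≤ dist x y) :
    r ≤ setDist s t :=
  le_csInf (hs.image2 ht) (by rintro _ ⟨x, hx, y, hy, rfl⟩; exact h x hx y hy)

theorem setDist_le_infDist {X : Type*} [MetricSpace X] {s t : Set X} {x : X}
    (hx : x ∈ s) (ht : t.Nonempty) : setDist s t ≤ Metric.infDist x t :=
  (Metric.le_infDist ht).2 fun _ hy => setDist_le_dist hx hy

theorem infDist_le_setDist_add_diam {X : Type*} [MetricSpace X] {s t : Set X} {x : X}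
    (hs : Bornology.IsBounded s) (hx : x ∈ s) (ht : t.Nonempty) :
    Metric.infDist x t ≤ setDist s t + Metric.diam s := by
  rw [← sub_le_iff_le_add]
  refine le_setDist ⟨x, hx⟩ ht fun z hz y hy => ?_
  have h₁ := Metric.infDist_le_dist_of_mem (x := x) hy
  have h₂ := dist_triangle x z y
  have h₃ := Metric.dist_le_diam_of_mem hs hx hz
  linarith

theorem dist_le_diam_add_setDist_add_diam {X : Type*} [MetricSpace X] {s t : Set X}
    {x y : X} (hs : Bornology.IsBounded s) (ht : Bornology.IsBounded t)
    (hx : x ∈ s) (hy : y ∈ t) :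
    dist x y ≤ Metric.diam s + setDist s t + Metric.diam t := by
  have h : dist x y - Metric.diam s - Metric.diam t ≤ setDist s t := by
    refine le_setDist ⟨x, hx⟩ ⟨y, hy⟩ fun z hz w hw => ?_
    have h₁ := dist_triangle4 x z w y
    have h₂ := Metric.dist_le_diam_of_mem hs hx hz
    have h₃ := Metric.dist_le_diam_of_mem ht hw hy
    linarith
  linarith

/-- The co-Lipschitz bound when the first set has the larger diameter. -/
theorem dist_le_infDist_sub_infDist_of_diam_le {X : Type*} [MetricSpace X] {T Λ : ℝ}
    (hT : 1 ≤ T) (hΛ : 0 < Λ) {Y Q R : Set X} (hY : Y.Nonempty)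
    (hQ : Bornology.IsBounded Q) (hR : Bornology.IsBounded R)
    (hQY : Metric.diam Q ≤ setDist Q Y) (hRY : setDist R Y ≤ Λ * Metric.diam R)
    (hRQ : Metric.diam R ≤ Metric.diam Q) (hlow : T * Metric.diam R ≤ setDist Q R)
    (hup : setDist Q R ≤ (T / (2 * (1 + Λ))) * Metric.diam Q)
    {p q : X} (hp : p ∈ Q) (hq : q ∈ R) :
    (4 + T)⁻¹ * dist p q ≤ Metric.infDist p Y - Metric.infDist q Y := by
  have hp' := setDist_le_infDist hp hY
  have hq' := infDist_le_setDist_add_diam hR hq hY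
  have hd := dist_le_diam_add_setDist_add_diam hQ hR hp hq
  have ha : 0 ≤ Metric.diam Q := Metric.diam_nonneg
  rw [div_mul_eq_mul_div, le_div_iff₀ (by positivity)] at hup
  have hsmall : 2 * (1 + Λ) * Metric.diam R ≤ Metric.diam Q := by
    have : T * (2 * (1 + Λ) * Metric.diam R) ≤ T * Metric.diam Q := by
      nlinarith [mul_le_mul_of_nonneg_right hlow (by positivity : 0 ≤ 2 * (1 + Λ))]
    exact le_of_mul_le_mul_left this (by linarith)
  have hD : 0 ≤ setDist Q R :=
    le_trans (mul_nonneg (by linarith) Metric.diam_nonneg) hlow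
  have hD' : 2 * setDist Q R ≤ T * Metric.diam Q := by nlinarith
  rw [inv_mul_le_iff₀ (by linarith)]
  have hhalf : Metric.diam Q / 2 ≤ Metric.infDist p Y - Metric.infDist q Y := by
    linarith
  nlinarith [mul_le_mul_of_nonneg_left hhalf (by linarith : 0 ≤ 4 + T)]

/-- (W-large scale co-Lipschitz bound from the distance to `Y`.)
For Whitney-type cubes with comparability constant `Λ` and a threshold `T ≥ 1`, there is
`c > 0` depending only on `T` and `Λ` such that for cubes `Q, R` with `d_W(Q,R) ≥ T` and
`dist(Q,R) ≤ (T/(2(1+Λ))) max(diam Q, diam R)` one has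
`|dist(p,Y) - dist(q,Y)| ≥ c·d(p,q)` for all `p ∈ Q`, `q ∈ R`. -/
theorem statement11 (T Λ : ℝ) (hT : 1 ≤ T) (hΛ : 0 < Λ) :
    ∃ c : ℝ, 0 < c ∧
      ∀ (X : Type) [MetricSpace X] (Y : Set X) (M : Set (Set X)),
        Y.Nonempty →
        (∀ Q ∈ M, Q.Nonempty ∧ Bornology.IsBounded Q ∧ Q ⊆ Yᶜ) →
        (∀ Q ∈ M, Metric.diam Q ≤ setDist Q Y ∧
          setDist Q Y ≤ Λ * Metric.diam Q) →
        ∀ Q ∈ M, ∀ R ∈ M,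
          T ≤ whitneyDist Q R →
          setDist Q R ≤ (T / (2 * (1 + Λ))) *
            max (Metric.diam Q) (Metric.diam R) →
          ∀ p ∈ Q, ∀ q ∈ R,
            c * dist p q ≤ |Metric.infDist p Y - Metric.infDist q Y| := by
  refine ⟨(4 + T)⁻¹, inv_pos.2 (by linarith), ?_⟩
  intro X _ Y M hY hM hW Q hQ R hR hlow hup p hp q hq
  have hmin : 0 < min (Metric.diam Q) (Metric.diam R) := by
    refine lt_of_le_of_ne (le_min Metric.diam_nonneg Metric.diam_nonneg) fun h => ?_
    rw [whitneyDist, ← h, div_zero] at hlow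
    linarith
  rw [whitneyDist, le_div_iff₀ hmin] at hlow
  rcases le_total (Metric.diam R) (Metric.diam Q) with h | h
  · rw [min_eq_right h] at hlow
    rw [max_eq_left h] at hup
    exact (dist_le_infDist_sub_infDist_of_diam_le hT hΛ hY (hM Q hQ).2.1 (hM R hR).2.1
      (hW Q hQ).1 (hW R hR).2 h hlow hup hp hq).trans (le_abs_self _)
  · rw [min_eq_left h, setDist_comm] at hlow
    rw [max_eq_right h, setDist_comm] at hup
    rw [abs_sub_comm, dist_comm]
    exact (dist_le_infDist_sub_infDist_of_diam_le hT hΛ hY (hM R hR).2.1 (hM Q hQ).2.1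
      (hW R hR).1 (hW Q hQ).2 h hlow hup hq hp).trans (le_abs_self _)
end

section
/- Let (X,d) be a metric space with diam(X) ≤ C₀·r for some r > 0, C₀ ≥ 1, covered by balls B(x₁,r),…,B(x_N,r). Let k ∈ ℕ, L ≥ 1, Λ ≥ 1, and for each i = 1,…,N let φᵢ : X → ℝᵏ be a map such that for all x, y ∈ B(xᵢ,5r): L⁻¹·d(x,y) ≤ |φᵢ(x) − φᵢ(y)| ≤ L·d(x,y) and r ≤ |φᵢ(x)| ≤ Λ·r. Let uᵢ, vᵢ : X → [0,1] be (1/r)-Lipschitz functions with uᵢ = 1 on B(xᵢ,r), uᵢ = 0 on X ∖ B(xᵢ,2r), vᵢ = 1 on B(xᵢ,4r), vᵢ = 0 on X ∖ B(xᵢ,5r). Then the map φ : X → ℝ^{2Nk} defined by φ(x) = (φ₁(x)u₁(x),…,φ_N(x)u_N(x), φ₁(x)v₁(x),…,φ_N(x)v_N(x)) is L'-bi-Lipschitz, where L' depends only on L, N, Λ and C₀. -/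
/-- A Lipschitz cutoff of a map that is Lipschitz and bounded on the support of the cutoff is
Lipschitz: if `w` is `(1/r)`-Lipschitz with values in `[0,1]` and vanishes off `s`, where `φ` is
`L`-Lipschitz and bounded by `Λ r`, then `w • φ` is `(L + Λ)`-Lipschitz. -/
theorem dist_cutoff_smul_le {X E : Type*} [MetricSpace X] [NormedAddCommGroup E]
    [NormedSpace ℝ E] {s : Set X} {φ : X → E} {w : X → ℝ} {r L Λ : ℝ} (hr : 0 < r)
    (hL : 0 ≤ L) (hΛ : 0 ≤ Λ)
    (hφ : ∀ a ∈ s, ∀ b ∈ s, dist (φ a) (φ b) ≤ L * dist a b)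
    (hbound : ∀ a ∈ s, ‖φ a‖ ≤ Λ * r)
    (hw : ∀ a, 0 ≤ w a ∧ w a ≤ 1)
    (hlip : ∀ a b, |w a - w b| ≤ (1 / r) * dist a b)
    (hzero : ∀ a ∉ s, w a = 0) (a b : X) :
    dist (w a • φ a) (w b • φ b) ≤ (L + Λ) * dist a b := by
  have key : ∀ a b, ∀ c ∈ s, ‖(w a - w b) • φ c‖ ≤ Λ * dist a b := fun a b c hc => by
    rw [norm_smul, Real.norm_eq_abs]
    calc |w a - w b| * ‖φ c‖ ≤ ((1 / r) * dist a b) * (Λ * r) :=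
          mul_le_mul (hlip a b) (hbound c hc) (norm_nonneg _) (by positivity)
      _ = Λ * dist a b := by field_simp
  have hLd : 0 ≤ L * dist a b := by positivity
  rw [dist_eq_norm, add_mul]
  by_cases hb : b ∈ s
  · by_cases ha : a ∈ s
    · have hsplit : w a • φ a - w b • φ b = w a • (φ a - φ b) + (w a - w b) • φ b := by
        module
      rw [hsplit]
      refine (norm_add_le _ _).trans (add_le_add ?_ (key a b b hb))
      rw [norm_smul, Real.norm_of_nonneg (hw a).1, ← dist_eq_norm]
      exact (mul_le_of_le_one_left dist_nonneg (hw a).2).trans (hφ a ha b hb)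
    · have h := key a b b hb
      rw [sub_smul, hzero a ha, zero_smul] at h
      rw [hzero a ha, zero_smul]
      linarith
  · by_cases ha : a ∈ s
    · have h := key a b a ha
      rw [sub_smul, hzero b hb, zero_smul] at h
      rw [hzero b hb, zero_smul]
      linarith
    · rw [hzero a ha, hzero b hb, zero_smul, zero_smul, sub_zero, norm_zero]
      positivity

/-- (Gluing uniformly bi-Lipschitz charts with two layers of Lipschitz
cutoffs.) If `X` has diameter at most `C₀ r`, is covered by balls `B(xᵢ, r)`, each chart
`φᵢ` is `L`-bi-Lipschitz on `B(xᵢ, 5r)` with `r ≤ |φᵢ| ≤ Λ r` there, and `uᵢ, vᵢ` are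
`(1/r)`-Lipschitz cutoffs as described, then the glued map
`p ↦ (φᵢ(p)uᵢ(p), φᵢ(p)vᵢ(p))ᵢ : X → ℝ^{2Nk}` is `L'`-bi-Lipschitz with `L'` depending
only on `L, N, Λ, C₀`. -/
theorem statement13 (L Λ C₀ : ℝ) (N : ℕ) (hL : 1 ≤ L) (hΛ : 1 ≤ Λ)
    (hC₀ : 1 ≤ C₀) :
    ∃ L' : ℝ, 1 ≤ L' ∧
      ∀ (X : Type) [MetricSpace X] (r : ℝ) (k : ℕ)
        (x : Fin N → X) (φ : Fin N → X → EuclideanSpace ℝ (Fin k))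
        (u v : Fin N → X → ℝ),
        0 < r →
        Metric.diam (Set.univ : Set X) ≤ C₀ * r →
        (Set.univ : Set X) ⊆ ⋃ i, Metric.ball (x i) r →
        (∀ i, ∀ a ∈ Metric.ball (x i) (5 * r), ∀ b ∈ Metric.ball (x i) (5 * r),
          L⁻¹ * dist a b ≤ dist (φ i a) (φ i b) ∧
          dist (φ i a) (φ i b) ≤ L * dist a b) →
        (∀ i, ∀ a ∈ Metric.ball (x i) (5 * r), r ≤ ‖φ i a‖ ∧ ‖φ i a‖ ≤ Λ * r) →
        (∀ i (a : X), 0 ≤ u i a ∧ u i a ≤ 1) →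
        (∀ i (a : X), 0 ≤ v i a ∧ v i a ≤ 1) →
        (∀ i (a b : X), |u i a - u i b| ≤ (1 / r) * dist a b) →
        (∀ i (a b : X), |v i a - v i b| ≤ (1 / r) * dist a b) →
        (∀ i, ∀ a ∈ Metric.ball (x i) r, u i a = 1) →
        (∀ i, ∀ a ∉ Metric.ball (x i) (2 * r), u i a = 0) →
        (∀ i, ∀ a ∈ Metric.ball (x i) (4 * r), v i a = 1) →
        (∀ i, ∀ a ∉ Metric.ball (x i) (5 * r), v i a = 0) →
        BiLipschitzOn
          (fun p : X =>
            ((fun i => u i p • φ i p, fun i => v i p • φ i p) :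
              (Fin N → EuclideanSpace ℝ (Fin k)) ×
              (Fin N → EuclideanSpace ℝ (Fin k))))
          Set.univ L' := by
  refine ⟨L + Λ + C₀, by linarith, ?_⟩
  intro X _ r k x φ u v hr hdiam hcover hφ hnorm hu hv hulip hvlip hu1 hu0 hv1 hv0
  have hbdd : Bornology.IsBounded (Set.univ : Set X) :=
    ((Bornology.isBounded_iUnion).2 fun _ => Metric.isBounded_ball).subset hcover
  intro p _ q _
  have hd : dist p q ≤ C₀ * r :=
    (Metric.dist_le_diam_of_mem hbdd (Set.mem_univ p) (Set.mem_univ q)).trans hdiam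
  have hpq : (0 : ℝ) ≤ dist p q := dist_nonneg
  refine ⟨?_, ?_⟩
  · obtain ⟨i, hi⟩ := Set.mem_iUnion.1 (hcover (Set.mem_univ p))
    rw [Prod.dist_eq]
    by_cases hq : q ∈ Metric.ball (x i) (4 * r)
    · have hp4 : p ∈ Metric.ball (x i) (4 * r) := Metric.ball_subset_ball (by linarith) hi
      have h45 : Metric.ball (x i) (4 * r) ⊆ Metric.ball (x i) (5 * r) :=
        Metric.ball_subset_ball (by linarith)
      refine le_trans ?_ (le_max_right _ _)
      refine le_trans ?_ (dist_le_pi_dist _ _ i)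
      simp only [hv1 i p hp4, hv1 i q hq, one_smul]
      refine le_trans ?_ (hφ i p (h45 hp4) q (h45 hq)).1
      gcongr
      linarith
    · have hq2 : q ∉ Metric.ball (x i) (2 * r) := fun h =>
        hq (Metric.ball_subset_ball (by linarith) h)
      have hp5 : p ∈ Metric.ball (x i) (5 * r) := Metric.ball_subset_ball (by linarith) hi
      refine le_trans ?_ (le_max_left _ _)
      refine le_trans ?_ (dist_le_pi_dist _ _ i)
      simp only [hu1 i p hi, hu0 i q hq2, one_smul, zero_smul, dist_zero_right]
      refine le_trans ?_ (hnorm i p hp5).1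
      rw [inv_mul_le_iff₀ (by linarith)]
      refine hd.trans ?_
      gcongr
      linarith
  · have hle : (L + Λ) * dist p q ≤ (L + Λ + C₀) * dist p q :=
      mul_le_mul_of_nonneg_right (by linarith) hpq
    refine le_trans ?_ hle
    have h0 : 0 ≤ (L + Λ) * dist p q := mul_nonneg (by linarith) hpq
    rw [Prod.dist_eq]
    refine max_le ((dist_pi_le_iff h0).2 fun i => ?_) ((dist_pi_le_iff h0).2 fun i => ?_)
    · exact dist_cutoff_smul_le hr (by linarith) (by linarith)
        (fun a ha b hb => (hφ i a ha b hb).2) (fun a ha => (hnorm i a ha).2) (hu i) (hulip i)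
        (fun a ha => hu0 i a fun h => ha (Metric.ball_subset_ball (by linarith) h)) p q
    · exact dist_cutoff_smul_le hr (by linarith) (by linarith)
        (fun a ha b hb => (hφ i a ha b hb).2) (fun a ha => (hnorm i a ha).2) (hv i) (hvlip i)
        (hv0 i) p q
end

section
/- Let x, y : [0,1] → ℝ be piecewise C¹ functions such that x(t) ≠ 0 for all but finitely many t. Write x₁ = x(0), y₁ = y(0), x₂ = x(1), y₂ = y(1). Then the Grushin length of the curve γ = (x,y) satisfies ∫₀¹ √(x'(t)² + y'(t)²/x(t)²) dt ≥ (1/2)·( |x₁ − x₂| + |y₁ − y₂| / √( min(|x₁|,|x₂|)² + 4|y₁ − y₂| ) ), where the second summand is interpreted as 0 when y₁ = y₂ and x₁ = x₂ = 0. -/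
/-- `f` is piecewise `C¹` on `[a,b]`: it is continuous on `[a,b]` and there is a
partition `a = t₀ < t₁ < ⋯ < tₙ = b` such that `f` is `C¹` on each `[tᵢ, tᵢ₊₁]`. -/
def PiecewiseC1On (f : ℝ → ℝ) (a b : ℝ) : Prop :=
  ContinuousOn f (Set.Icc a b) ∧
  ∃ (n : ℕ) (t : ℕ → ℝ), t 0 = a ∧ t n = b ∧ (∀ i < n, t i < t (i + 1)) ∧
    ∀ i < n, ContDiffOn ℝ 1 f (Set.Icc (t i) (t (i + 1)))

/-- The Grushin length of the curve `γ = (x,y) : [0,1] → ℝ²`: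
`∫₀¹ √(x'(t)² + y'(t)²/x(t)²) dt`, as a Lebesgue integral valued in `[0,∞]` of the
almost-everywhere defined integrand. -/
noncomputable def grushinLength (x y : ℝ → ℝ) : ENNReal :=
  ∫⁻ t in Set.Ioo (0:ℝ) 1,
    ENNReal.ofReal (Real.sqrt ((deriv x t) ^ 2 + (deriv y t) ^ 2 / (x t) ^ 2))

open MeasureTheory in
/-- The fundamental theorem of calculus as an inequality for piecewise `C¹` functions. -/
theorem PiecewiseC1On.enorm_sub_le_lintegral {f : ℝ → ℝ} {a b s u : ℝ}
    (hf : PiecewiseC1On f a b) (has : a ≤ s) (hsu : s ≤ u) (hub : u ≤ b) :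
    ‖f u - f s‖ₑ ≤ ∫⁻ r in Set.Ioo a b, ‖deriv f r‖ₑ := by
  obtain ⟨hcont, n, t, h0, hn, hlt, hC⟩ := hf
  have hderiv : ∀ i < n, ∀ r ∈ Set.Ioo (t i) (t (i + 1)), HasDerivAt f (deriv f r) r :=
    fun i hi r hr => ((hC i hi).contDiffAt (Icc_mem_nhds hr.1 hr.2)).differentiableAt
      one_ne_zero |>.hasDerivAt
  have hint : IntervalIntegrable (deriv f) volume a b := by
    rw [← h0, ← hn]
    refine IntervalIntegrable.trans_iterate fun i hi => ?_
    have hle := (hlt i hi).le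
    have hw : ContinuousOn (derivWithin f (Set.Icc (t i) (t (i + 1))))
        (Set.Icc (t i) (t (i + 1))) :=
      (hC i hi).continuousOn_derivWithin (uniqueDiffOn_Icc (hlt i hi)) le_rfl
    rw [intervalIntegrable_iff_integrableOn_Ioo_of_le hle]
    refine IntegrableOn.congr_fun (hw.integrableOn_Icc.mono_set Set.Ioo_subset_Icc_self)
      (fun r hr => derivWithin_of_mem_nhds (Icc_mem_nhds hr.1 hr.2)) measurableSet_Ioo
  have hcover : ∀ k ≤ n, ∀ r, t 0 < r → r < t k → r ∉ Set.range t →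
      ∃ i < n, r ∈ Set.Ioo (t i) (t (i + 1)) := by
    intro k
    induction k with
    | zero => intro _ r h1 h2; linarith
    | succ k ih =>
      intro hk r h1 h2 hr
      rcases lt_trichotomy r (t k) with h | h | h
      · exact ih (by omega) r h1 h hr
      · exact absurd ⟨k, h.symm⟩ hr
      · exact ⟨k, by omega, h, h2⟩
  have hFTC : ∫ r in s..u, deriv f r = f u - f s := by
    refine integral_eq_of_hasDerivAt_off_countable_of_le f (deriv f) hsu
      (Set.countable_range t) (hcont.mono (Set.Icc_subset_Icc has hub)) (fun r hr => ?_)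
      (hint.mono_set ?_)
    · obtain ⟨i, hi, hri⟩ := hcover n le_rfl r (by rw [h0]; linarith [hr.1.1])
        (by rw [hn]; linarith [hr.1.2]) hr.2
      exact hderiv i hi r hri
    · rw [Set.uIcc_of_le hsu, Set.uIcc_of_le (by linarith)]
      exact Set.Icc_subset_Icc has hub
  rw [← hFTC, intervalIntegral.integral_of_le hsu, integral_Ioc_eq_integral_Ioo]
  exact (enorm_integral_le_lintegral_enorm _).trans
    (lintegral_mono_set (Set.Ioo_subset_Ioo has hub))

/-- If `d ≤ (m + l) l`, then `l` is at least half the sum of `δ` and `d / √(m² + 4d)`. -/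
theorem half_add_div_sqrt_le {m d l δ : ℝ} (hm : 0 ≤ m) (hd : 0 ≤ d) (hl : 0 ≤ l)
    (hδ : δ ≤ l) (h : d ≤ (m + l) * l) :
    1 / 2 * (δ + d / Real.sqrt (m ^ 2 + 4 * d)) ≤ l := by
  have key : d / Real.sqrt (m ^ 2 + 4 * d) ≤ l := by
    have hsq := Real.sq_sqrt (show 0 ≤ m ^ 2 + 4 * d by positivity)
    have hms : m ≤ Real.sqrt (m ^ 2 + 4 * d) := Real.le_sqrt_of_sq_le (by linarith)
    set S := Real.sqrt (m ^ 2 + 4 * d)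
    have hSl : S ≤ m + 2 * l := by
      by_contra! hlt
      nlinarith
    refine div_le_of_le_mul₀ (by linarith) hl ?_
    nlinarith
  linarith

open MeasureTheory in
/-- (Lower bound on the Grushin length of a horizontal curve.) For a
piecewise `C¹` curve `γ = (x,y)` on `[0,1]` whose first coordinate vanishes only finitely
often, the Grushin length is at least
`(1/2)(|x₁-x₂| + |y₁-y₂|/√(min(|x₁|,|x₂|)² + 4|y₁-y₂|))`, where the second summand is
read as `0` when `y₁ = y₂` and `x₁ = x₂ = 0`. -/
theorem statement14 (x y : ℝ → ℝ)
    (hx : PiecewiseC1On x 0 1) (hy : PiecewiseC1On y 0 1)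
    (hfin : {t ∈ Set.Icc (0:ℝ) 1 | x t = 0}.Finite) :
    ENNReal.ofReal ((1 / 2) * (|x 0 - x 1| +
        |y 0 - y 1| / Real.sqrt ((min |x 0| |x 1|) ^ 2 + 4 * |y 0 - y 1|))) ≤
      grushinLength x y := by
  by_cases htop : grushinLength x y = ⊤
  · simp [htop]
  set l := (grushinLength x y).toReal with hl_def
  have hl : 0 ≤ l := ENNReal.toReal_nonneg
  have hofl : ENNReal.ofReal l = grushinLength x y := ENNReal.ofReal_toReal htop
  have hxle : ∀ s u, 0 ≤ s → s ≤ u → u ≤ 1 → |x u - x s| ≤ l := by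
    intro s u hs hsu hu
    rw [← ENNReal.ofReal_le_ofReal_iff hl, hofl, ← Real.norm_eq_abs, ofReal_norm]
    refine (hx.enorm_sub_le_lintegral hs hsu hu).trans (lintegral_mono fun r => ?_)
    rw [← ofReal_norm, Real.norm_eq_abs]
    exact ENNReal.ofReal_le_ofReal (Real.abs_le_sqrt (le_add_of_nonneg_right (by positivity)))
  set m := min |x 0| |x 1| with hm_def
  have hm : 0 ≤ m := le_min (abs_nonneg _) (abs_nonneg _)
  have hxbound : ∀ r ∈ Set.Ioo (0:ℝ) 1, |x r| ≤ m + l := by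
    intro r hr
    have h0 := hxle 0 r le_rfl hr.1.le hr.2.le
    have h1 := hxle r 1 hr.1.le hr.2.le le_rfl
    have h2 := abs_sub_abs_le_abs_sub (x r) (x 0)
    have h3 := abs_sub_abs_le_abs_sub (x r) (x 1)
    rw [abs_sub_comm (x r) (x 1)] at h3
    rw [← sub_le_iff_le_add]
    exact le_min (by linarith) (by linarith)
  have hyle : |y 0 - y 1| ≤ (m + l) * l := by
    rw [← ENNReal.ofReal_le_ofReal_iff (by positivity), ENNReal.ofReal_mul (by positivity), hofl,
      abs_sub_comm, ← Real.norm_eq_abs, ofReal_norm]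
    refine (hy.enorm_sub_le_lintegral le_rfl zero_le_one le_rfl).trans ?_
    rw [grushinLength, ← lintegral_const_mul' _ _ ENNReal.ofReal_ne_top]
    refine lintegral_mono_ae ?_
    have hne : ∀ᵐ r ∂(volume.restrict (Set.Ioo (0:ℝ) 1)),
        r ∉ {t ∈ Set.Icc (0:ℝ) 1 | x t = 0} :=
      ae_restrict_of_ae (measure_eq_zero_iff_ae_notMem.1 (hfin.measure_zero volume))
    filter_upwards [hne, ae_restrict_mem measurableSet_Ioo] with r hr hr01
    have hxr : x r ≠ 0 := fun h => hr ⟨Set.Ioo_subset_Icc_self hr01, h⟩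
    rw [← ENNReal.ofReal_mul (by positivity), ← ofReal_norm, Real.norm_eq_abs]
    refine ENNReal.ofReal_le_ofReal ?_
    calc |deriv y r| = |x r| * |deriv y r / x r| := by
          rw [← abs_mul, mul_div_cancel₀ _ hxr]
      _ ≤ (m + l) * Real.sqrt ((deriv x r) ^ 2 + (deriv y r) ^ 2 / (x r) ^ 2) := by
          refine mul_le_mul (hxbound r hr01) (Real.abs_le_sqrt ?_) (abs_nonneg _) (by positivity)
          rw [div_pow]
          exact le_add_of_nonneg_left (sq_nonneg _)
  rw [← hofl]
  refine ENNReal.ofReal_le_ofReal (half_add_div_sqrt_le hm (abs_nonneg _) hl ?_ hyle)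
  rw [abs_sub_comm]
  exact hxle 0 1 le_rfl zero_le_one le_rfl
end

section
/- Define d_cc : ℝ² × ℝ² → [0,∞] by letting d_cc(p,q) be the infimum of ∫₀¹ √(x'(t)² + y'(t)²/x(t)²) dt over all piecewise C¹ curves γ = (x,y) : [0,1] → ℝ² with γ(0) = p, γ(1) = q and x(t) ≠ 0 for all but finitely many t. Then the Grushin plane embeds bi-Lipschitzly into Euclidean space: there exist N ∈ ℕ, L ≥ 1, and a map F : ℝ² → ℝ^N such that L⁻¹·d_cc(p,q) ≤ |F(p) − F(q)| ≤ L·d_cc(p,q) for all p, q ∈ ℝ². -/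
/-- The Carnot–Carathéodory distance of the Grushin plane: the infimum of Grushin lengths
of piecewise `C¹` curves `γ = (x,y) : [0,1] → ℝ²` joining `p` to `q` whose first
coordinate is nonzero for all but finitely many `t`, valued in `[0,∞]`. -/
noncomputable def grushinDist (p q : ℝ × ℝ) : ENNReal :=
  ⨅ (x : ℝ → ℝ) (y : ℝ → ℝ) (_ : PiecewiseC1On x 0 1) (_ : PiecewiseC1On y 0 1)
    (_ : {t ∈ Set.Icc (0:ℝ) 1 | x t = 0}.Finite)
    (_ : x 0 = p.1 ∧ y 0 = p.2 ∧ x 1 = q.1 ∧ y 1 = q.2),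
    grushinLength x y

open MeasureTheory Set

/-- One scale of the embedding: a Lipschitz cutoff to `|x| ≤ 2s` of amplitude `s`, times a
circle-valued function of `y` of period comparable to `s ^ 2`. -/
noncomputable def grushinTerm (s : ℝ) (p : ℝ × ℝ) : ℂ :=
  ((max 0 (min s (2 * s - |p.1|)) : ℝ) : ℂ) *
    (Complex.exp (Complex.I * (p.2 / s ^ 2 : ℝ)) - 1)

lemma norm_exp_I_mul_ofReal_sub_exp (a b : ℝ) :
    ‖Complex.exp (Complex.I * a) - Complex.exp (Complex.I * b)‖ =
      ‖Complex.exp (Complex.I * (a - b : ℝ)) - 1‖ := by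
  have h : Complex.exp (Complex.I * a) - Complex.exp (Complex.I * b) =
      Complex.exp (Complex.I * b) * (Complex.exp (Complex.I * (a - b : ℝ)) - 1) := by
    rw [mul_sub, ← Complex.exp_add]
    push_cast
    ring_nf
  rw [h, norm_mul, Complex.norm_exp_I_mul_ofReal, one_mul]

lemma half_le_norm_exp_I_mul_ofReal_sub_one {a : ℝ} (ha : |a| ≤ 1) :
    |a| / 2 ≤ ‖Complex.exp (Complex.I * a) - 1‖ := by
  rw [Complex.norm_exp_I_mul_ofReal_sub_one, Real.norm_eq_abs, abs_mul, abs_two]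
  have hpi := Real.pi_gt_three
  have h1 : |Real.sin (a / 2)| = Real.sin (|a| / 2) := by
    rcases abs_cases a with ⟨h, h'⟩ | ⟨h, h'⟩
    · rw [h, abs_of_nonneg]
      exact Real.sin_nonneg_of_nonneg_of_le_pi (by linarith) (by linarith)
    · rw [h, neg_div, Real.sin_neg, abs_of_nonpos]
      have := Real.sin_nonneg_of_nonneg_of_le_pi (x := -a / 2) (by linarith) (by linarith)
      rw [neg_div, Real.sin_neg] at this
      linarith
  have h2 : (2 / Real.pi) * (|a| / 2) ≤ Real.sin (|a| / 2) :=
    Real.mul_le_sin (by positivity) (by linarith)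
  have h3 : 1 / 2 ≤ 2 / Real.pi := by
    rw [div_le_div_iff₀ two_pos Real.pi_pos]
    linarith [Real.pi_le_four]
  rw [h1]
  nlinarith [abs_nonneg a]

lemma norm_exp_I_mul_ofReal_sub_one_le_two (a : ℝ) :
    ‖Complex.exp (Complex.I * a) - 1‖ ≤ 2 := by
  rw [Complex.norm_exp_I_mul_ofReal_sub_one, Real.norm_eq_abs, abs_mul, abs_two]
  linarith [Real.abs_sin_le_one (a / 2)]

lemma norm_grushinTerm_sub_of_abs_le {s : ℝ} (hs : 0 < s) {p q : ℝ × ℝ}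
    (hp : |p.1| ≤ s) (hq : |q.1| ≤ s) :
    ‖grushinTerm s q - grushinTerm s p‖ =
      s * ‖Complex.exp (Complex.I * ((q.2 - p.2) / s ^ 2 : ℝ)) - 1‖ := by
  unfold grushinTerm
  rw [min_eq_left (by linarith), min_eq_left (by linarith), max_eq_right hs.le, ← mul_sub,
    sub_sub_sub_cancel_right, norm_mul, norm_exp_I_mul_ofReal_sub_exp, sub_div,
    Complex.norm_real, Real.norm_of_nonneg hs.le]

lemma norm_grushinTerm_sub_le_div {s : ℝ} (hs : 0 < s) {p q : ℝ × ℝ}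
    (hp : |p.1| ≤ s) (hq : |q.1| ≤ s) :
    ‖grushinTerm s q - grushinTerm s p‖ ≤ |q.2 - p.2| / s := by
  rw [norm_grushinTerm_sub_of_abs_le hs hp hq]
  have h := Real.norm_exp_I_mul_ofReal_sub_one_le (x := (q.2 - p.2) / s ^ 2)
  rw [Real.norm_eq_abs, abs_div, abs_of_pos (pow_pos hs 2)] at h
  calc _ ≤ s * (|q.2 - p.2| / s ^ 2) := by gcongr
    _ = _ := by field_simp

lemma div_le_norm_grushinTerm_sub {s : ℝ} (hs : 0 < s) {p q : ℝ × ℝ}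
    (hp : |p.1| ≤ s) (hq : |q.1| ≤ s) (hpq : |q.2 - p.2| ≤ s ^ 2) :
    |q.2 - p.2| / (2 * s) ≤ ‖grushinTerm s q - grushinTerm s p‖ := by
  rw [norm_grushinTerm_sub_of_abs_le hs hp hq]
  have ha : |(q.2 - p.2) / s ^ 2| = |q.2 - p.2| / s ^ 2 := by
    rw [abs_div, abs_of_pos (pow_pos hs 2)]
  have h := half_le_norm_exp_I_mul_ofReal_sub_one (a := (q.2 - p.2) / s ^ 2)
    (by rw [ha]; exact div_le_one_of_le₀ hpq (by positivity))
  rw [ha] at h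
  calc _ = s * (|q.2 - p.2| / s ^ 2 / 2) := by field_simp
    _ ≤ _ := by gcongr

lemma grushinTerm_eq_zero {s : ℝ} {p : ℝ × ℝ} (hp : 2 * s ≤ |p.1|) :
    grushinTerm s p = 0 := by
  unfold grushinTerm
  rw [max_eq_left ((min_le_right _ _).trans (by linarith))]
  simp

lemma norm_grushinTerm_le {s : ℝ} (hs : 0 < s) (p : ℝ × ℝ) : ‖grushinTerm s p‖ ≤ 2 * s := by
  unfold grushinTerm
  rw [norm_mul, Complex.norm_real, Real.norm_of_nonneg (le_max_left _ _), mul_comm]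
  exact mul_le_mul (norm_exp_I_mul_ofReal_sub_one_le_two _)
    (max_le hs.le (min_le_left _ _)) (le_max_left _ _) zero_le_two

lemma norm_grushinTerm_sub_le_mul {s : ℝ} (hs : 0 < s) (p q : ℝ × ℝ) :
    ‖grushinTerm s q - grushinTerm s p‖ ≤ 4 * s :=
  (norm_sub_le _ _).trans (by linarith [norm_grushinTerm_le hs p, norm_grushinTerm_le hs q])

lemma norm_grushinTerm_sub_le {s : ℝ} (hs : 0 < s) (p q : ℝ × ℝ) :
    ‖grushinTerm s q - grushinTerm s p‖ ≤ 2 * |q.1 - p.1| + |q.2 - p.2| / s := by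
  have hcut : |max 0 (min s (2 * s - |q.1|)) - max 0 (min s (2 * s - |p.1|))| ≤
      |q.1 - p.1| := by
    refine (abs_max_sub_max_le_max _ _ _ _).trans (max_le (by simp) ?_)
    refine (abs_min_sub_min_le_max _ _ _ _).trans (max_le (by simp) ?_)
    rw [sub_sub_sub_cancel_left, abs_sub_comm q.1]
    exact abs_abs_sub_abs_le_abs_sub _ _
  have h := Real.norm_exp_I_mul_ofReal_sub_one_le (x := q.2 / s ^ 2 - p.2 / s ^ 2)
  rw [← norm_exp_I_mul_ofReal_sub_exp, ← sub_div, Real.norm_eq_abs, abs_div,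
    abs_of_pos (pow_pos hs 2)] at h
  unfold grushinTerm
  set a := max 0 (min s (2 * s - |q.1|))
  set b := max 0 (min s (2 * s - |p.1|))
  have hb : |b| ≤ s := by
    rw [abs_of_nonneg (le_max_left _ _)]
    exact max_le hs.le (min_le_left _ _)
  set u := Complex.exp (Complex.I * (q.2 / s ^ 2 : ℝ))
  set v := Complex.exp (Complex.I * (p.2 / s ^ 2 : ℝ))
  have hu : ‖u - 1‖ ≤ 2 := norm_exp_I_mul_ofReal_sub_one_le_two _
  calc ‖(a : ℂ) * (u - 1) - b * (v - 1)‖ = ‖((a - b : ℝ) : ℂ) * (u - 1) + b * (u - v)‖ := by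
        congr 1; push_cast; ring
    _ ≤ |a - b| * ‖u - 1‖ + |b| * ‖u - v‖ := by
        refine (norm_add_le _ _).trans ?_
        rw [norm_mul, norm_mul, Complex.norm_real, Complex.norm_real, Real.norm_eq_abs,
          Real.norm_eq_abs]
    _ ≤ |q.1 - p.1| * 2 + s * (|q.2 - p.2| / s ^ 2) := by gcongr
    _ = _ := by field_simp

lemma hasSum_int_half_pow_natAbs : HasSum (fun i : ℤ => (1 / 2 : ℝ) ^ i.natAbs) 3 := by
  have h : HasSum (fun n : ℕ => (1 / 2 : ℝ) ^ (n + 1)) 1 := by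
    have h2 := hasSum_geometric_two.mul_right (1 / 2 : ℝ)
    simp only [← pow_succ] at h2
    norm_num at h2 ⊢
    exact h2
  have h3 := HasSum.of_nat_of_neg_add_one (f := fun i : ℤ => (1 / 2 : ℝ) ^ i.natAbs)
    (m := 2) (m' := 1) (by simpa using hasSum_geometric_two)
    (by
      convert h using 3 with n
      omega)
  norm_num at h3 ⊢
  exact h3

lemma half_pow_natAbs_sub_of_le {k n : ℤ} (h : k ≤ n) :
    (1 / 2 : ℝ) ^ (k - n).natAbs = 2 ^ k / 2 ^ n := by
  rw [← zpow_sub₀ two_ne_zero, one_div, inv_pow, ← zpow_natCast, ← zpow_neg]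
  congr 1
  omega

lemma norm_grushinTerm_sub_le_decay {l : ℝ} (hl : 0 < l) {p q : ℝ × ℝ}
    (h1 : |q.1 - p.1| ≤ l) (h2 : |q.2 - p.2| ≤ (|p.1| + l) * l) :
    ∃ n : ℤ, ∀ k : ℤ, ‖grushinTerm (2 ^ k) q - grushinTerm (2 ^ k) p‖ ≤
      40 * l * (1 / 2) ^ (k - n).natAbs := by
  obtain ⟨m, hm, hm'⟩ := exists_mem_Ioc_zpow (x := |p.1| + l) (y := 2) (by positivity) one_lt_two
  refine ⟨m + 1, fun k => ?_⟩
  have hN : (2 : ℝ) ^ (m + 1) = 2 * 2 ^ m := by rw [zpow_add_one₀ two_ne_zero, mul_comm]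
  have hk : (0 : ℝ) < 2 ^ k := by positivity
  have hp0 := abs_nonneg p.1
  have hqp : |q.1| ≤ |p.1| + l := by
    linarith [abs_sub_abs_le_abs_sub q.1 p.1]
  have hpq : |p.1| ≤ |q.1| + l := by
    linarith [abs_sub_abs_le_abs_sub p.1 q.1, abs_sub_comm p.1 q.1]
  have hD : |q.2 - p.2| ≤ 2 ^ (m + 1) * l := h2.trans (by gcongr)
  rcases le_total (m + 1) k with hmk | hmk
  · have hle : (2 : ℝ) ^ (m + 1) ≤ 2 ^ k := zpow_le_zpow_right₀ one_le_two hmk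
    refine (norm_grushinTerm_sub_le_div hk (by linarith) (by linarith)).trans ?_
    rw [← Int.natAbs_neg, neg_sub, half_pow_natAbs_sub_of_le hmk, mul_div_assoc']
    gcongr
    nlinarith
  · rw [half_pow_natAbs_sub_of_le hmk, mul_div_assoc', le_div_iff₀ (by positivity)]
    rcases le_total |p.1| (4 * l) with hpl | hpl
    · nlinarith [norm_grushinTerm_sub_le_mul hk p q]
    · rcases le_or_gt k (m - 2) with hkm | hkm
      · have hle : (2 : ℝ) ^ k ≤ 2 ^ (m - 2) := zpow_le_zpow_right₀ one_le_two hkm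
        have hN' : (2 : ℝ) ^ (m - 2) = 2 ^ m / 4 := by
          rw [zpow_sub₀ two_ne_zero]
          norm_num
        rw [grushinTerm_eq_zero (by linarith), grushinTerm_eq_zero (by linarith)]
        simp only [sub_self, norm_zero, zero_mul]
        positivity
      · have hle : (2 : ℝ) ^ (m + 1) ≤ 4 * 2 ^ k := by
          calc (2 : ℝ) ^ (m + 1) ≤ 2 ^ (k + 2) := zpow_le_zpow_right₀ one_le_two (by omega)
            _ = 4 * 2 ^ k := by
              rw [zpow_add₀ two_ne_zero]
              norm_num
              ring
        have hterm : ‖grushinTerm (2 ^ k) q - grushinTerm (2 ^ k) p‖ ≤ 6 * l := by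
          refine (norm_grushinTerm_sub_le hk p q).trans ?_
          have : |q.2 - p.2| / 2 ^ k ≤ 4 * l := by
            rw [div_le_iff₀ hk]
            nlinarith
          linarith
        nlinarith

/-- The sum of the terms of the embedding over the scales `2 ^ (10 i + j)`, `i ∈ ℤ`. -/
noncomputable def grushinSeries (j : Fin 10) (p : ℝ × ℝ) : ℂ :=
  ∑' i : ℤ, grushinTerm (2 ^ (10 * i + (j : ℕ))) p

lemma summable_half_pow_natAbs_comp (j n : ℤ) :
    Summable fun i : ℤ => (1 / 2 : ℝ) ^ (10 * i + j - n).natAbs :=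
  hasSum_int_half_pow_natAbs.summable.comp_injective (i := fun i : ℤ => 10 * i + j - n)
    fun a b h => by simp only at h; omega

lemma tsum_half_pow_natAbs_comp_le (j n : ℤ) :
    ∑' i : ℤ, (1 / 2 : ℝ) ^ (10 * i + j - n).natAbs ≤ 3 := by
  rw [← hasSum_int_half_pow_natAbs.tsum_eq]
  exact Summable.tsum_le_tsum_of_inj (fun i : ℤ => 10 * i + j - n)
    (fun a b h => by simp only at h; omega) (fun _ _ => by positivity) (fun _ => le_rfl)
    (summable_half_pow_natAbs_comp j n) hasSum_int_half_pow_natAbs.summable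

lemma summable_grushinTerm (j : Fin 10) (p : ℝ × ℝ) :
    Summable fun i : ℤ => grushinTerm (2 ^ (10 * i + (j : ℕ))) p := by
  obtain ⟨n, hn⟩ := norm_grushinTerm_sub_le_decay (l := |p.1| + |p.2| + 1) (p := 0) (q := p)
    (by positivity) (by simp only [Prod.fst_zero, sub_zero]; linarith [abs_nonneg p.2])
    (by
      simp only [Prod.fst_zero, Prod.snd_zero, sub_zero, abs_zero]
      nlinarith [abs_nonneg p.2, abs_nonneg p.1])
  refine Summable.of_norm_bounded
    ((summable_half_pow_natAbs_comp j n).mul_left (40 * (|p.1| + |p.2| + 1))) fun i => ?_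
  simpa [grushinTerm] using hn (10 * i + (j : ℕ))

lemma grushinSeries_sub (j : Fin 10) (p q : ℝ × ℝ) :
    grushinSeries j q - grushinSeries j p =
      ∑' i : ℤ, (grushinTerm (2 ^ (10 * i + (j : ℕ))) q -
        grushinTerm (2 ^ (10 * i + (j : ℕ))) p) :=
  ((summable_grushinTerm j q).tsum_sub (summable_grushinTerm j p)).symm

lemma norm_grushinSeries_sub_le (j : Fin 10) {l : ℝ} (hl : 0 < l) {p q : ℝ × ℝ}
    (h1 : |q.1 - p.1| ≤ l) (h2 : |q.2 - p.2| ≤ (|p.1| + l) * l) :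
    ‖grushinSeries j q - grushinSeries j p‖ ≤ 120 * l := by
  obtain ⟨n, hn⟩ := norm_grushinTerm_sub_le_decay hl h1 h2
  rw [grushinSeries_sub]
  refine (tsum_of_norm_bounded ((summable_half_pow_natAbs_comp j n).mul_left (40 * l)).hasSum
    fun i => hn _).trans ?_
  rw [tsum_mul_left]
  nlinarith [tsum_half_pow_natAbs_comp_le j n]

/-- A series dominated by its term of index `i₀`, with fast geometric decay away from it. -/
lemma half_le_norm_tsum_of_lacunary {f : ℤ → ℂ} (hf : Summable f) (i₀ : ℤ) {A : ℝ}
    (hA : 0 ≤ A) (h₀ : A ≤ ‖f i₀‖)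
    (h : ∀ i ≠ i₀, ‖f i‖ ≤ 32 * A * (1 / 2) ^ (10 * (i - i₀).natAbs)) :
    A / 2 ≤ ‖∑' i, f i‖ := by
  rw [hf.tsum_eq_add_tsum_ite i₀]
  have hs : HasSum (fun i : ℤ => A / 16 * (1 / 2 : ℝ) ^ (i - i₀).natAbs) (A / 16 * 3) :=
    ((Equiv.subRight i₀).hasSum_iff.mpr hasSum_int_half_pow_natAbs).mul_left _
  have ht : ‖∑' i, if i = i₀ then 0 else f i‖ ≤ A / 16 * 3 := by
    refine tsum_of_norm_bounded hs fun i => ?_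
    split_ifs with hi
    · simp only [norm_zero]
      positivity
    · refine (h i hi).trans ?_
      obtain ⟨n, hn⟩ : ∃ n, (i - i₀).natAbs = n + 1 :=
        Nat.exists_eq_succ_of_ne_zero (by omega)
      rw [hn, show 10 * (n + 1) = 9 * n + 9 + (n + 1) by ring, pow_add, pow_add]
      have h9 : (1 / 2 : ℝ) ^ (9 * n) ≤ 1 := pow_le_one₀ (by norm_num) (by norm_num)
      calc 32 * A * ((1 / 2 : ℝ) ^ (9 * n) * (1 / 2) ^ 9 * (1 / 2) ^ (n + 1))
          ≤ 32 * A * (1 * (1 / 2) ^ 9 * (1 / 2) ^ (n + 1)) := by gcongr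
        _ = A / 16 * (1 / 2 : ℝ) ^ (n + 1) := by ring
  have := norm_sub_le_norm_add (f i₀) (∑' i, if i = i₀ then 0 else f i)
  linarith

lemma exists_div_le_norm_grushinSeries_sub {R : ℝ} (hR : 0 < R) {p q : ℝ × ℝ}
    (hp : |p.1| ≤ R) (hq : |q.1| ≤ R) (hD : |q.2 - p.2| ≤ R ^ 2)
    (h : R ^ 2 ≤ |q.2 - p.2| ∨ R / 2 ≤ |p.1| ∧ R / 2 ≤ |q.1|) :
    ∃ j, |q.2 - p.2| / (8 * R) ≤ ‖grushinSeries j q - grushinSeries j p‖ := by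
  obtain ⟨m, hm, hm'⟩ := exists_mem_Ioc_zpow hR one_lt_two
  set k := m + 1
  set D := |q.2 - p.2|
  have hD0 : 0 ≤ D := abs_nonneg _
  have hk : (0 : ℝ) < 2 ^ k := by positivity
  have hkm : (2 : ℝ) ^ k = 2 * 2 ^ m := by rw [zpow_add_one₀ two_ne_zero, mul_comm]
  obtain ⟨i₀, j, hj⟩ : ∃ (i₀ : ℤ) (j : Fin 10), 10 * i₀ + (j : ℕ) = k :=
    ⟨k / 10, ⟨(k % 10).toNat, by omega⟩, by simp only; omega⟩
  refine ⟨j, ?_⟩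
  rw [grushinSeries_sub]
  have key := half_le_norm_tsum_of_lacunary
    ((summable_grushinTerm j q).sub (summable_grushinTerm j p)) i₀ (A := D / (2 * 2 ^ k))
    (by positivity)
    (by
      simp only [hj]
      exact div_le_norm_grushinTerm_sub hk (hp.trans hm') (hq.trans hm')
        (hD.trans (by gcongr)))
    (by
      intro i hi
      set k' := 10 * i + ((j : ℕ) : ℤ)
      have hk' : (0 : ℝ) < 2 ^ k' := by positivity
      have hi' : 10 * (i - i₀).natAbs = (k' - k).natAbs := by omega
      rw [hi']
      rcases lt_or_gt_of_ne hi with hlt | hlt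
      · rw [half_pow_natAbs_sub_of_le (by omega)]
        have hle : (2 : ℝ) ^ k' ≤ 2 ^ (m - 2) := zpow_le_zpow_right₀ one_le_two (by omega)
        have hN' : (2 : ℝ) ^ (m - 2) = 2 ^ m / 4 := by
          rw [zpow_sub₀ two_ne_zero]
          norm_num
        rcases h with h | ⟨h, h'⟩
        · refine (norm_grushinTerm_sub_le_mul hk' p q).trans ?_
          rw [show 32 * (D / (2 * 2 ^ k)) * (2 ^ k' / 2 ^ k : ℝ) =
            2 ^ k' * (16 * D / (2 ^ k) ^ 2) by field_simp; ring, mul_comm]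
          gcongr
          rw [le_div_iff₀ (by positivity)]
          nlinarith
        · rw [grushinTerm_eq_zero (by linarith), grushinTerm_eq_zero (by linarith)]
          simp only [sub_self, norm_zero]
          positivity
      · rw [← Int.natAbs_neg, neg_sub, half_pow_natAbs_sub_of_le (by omega)]
        have hle : (2 : ℝ) ^ k ≤ 2 ^ k' := zpow_le_zpow_right₀ one_le_two (by omega)
        refine (norm_grushinTerm_sub_le_div hk' (by linarith) (by linarith)).trans ?_
        rw [show 32 * (D / (2 * 2 ^ k)) * (2 ^ k / 2 ^ k' : ℝ) = 16 * D / 2 ^ k' by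
          field_simp; ring]
        gcongr
        linarith)
  refine le_trans ?_ key
  rw [div_div]
  exact div_le_div_of_nonneg_left hD0 (by positivity) (by linarith)

lemma abs_snd_sub_le_of_grushinSeries {r : ℝ} {p q : ℝ × ℝ}
    (h1 : |q.1 - p.1| ≤ r) (h2 : ∀ j, ‖grushinSeries j q - grushinSeries j p‖ ≤ r) :
    |q.2 - p.2| ≤ 64 * (|p.1| + r) * r := by
  have hr : 0 ≤ r := (abs_nonneg _).trans h1
  have hp0 := abs_nonneg p.1
  set D := |q.2 - p.2| with hDdef
  have hD0 : 0 ≤ D := abs_nonneg _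
  have hqp : |q.1| ≤ |p.1| + r := by linarith [abs_sub_abs_le_abs_sub q.1 p.1]
  have hpq : |p.1| ≤ |q.1| + r := by
    linarith [abs_sub_abs_le_abs_sub p.1 q.1, abs_sub_comm p.1 q.1]
  set M := max |p.1| |q.1|
  have hpM : |p.1| ≤ M := le_max_left _ _
  have hqM : |q.1| ≤ M := le_max_right _ _
  have hM : M ≤ |p.1| + r := max_le (by linarith) hqp
  rcases hD0.eq_or_lt with hD | hD
  · rw [← hD]
    positivity
  rcases le_total (M ^ 2) D with hMD | hMD
  · have hs : √D ^ 2 = D := Real.sq_sqrt hD0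
    have hs0 : 0 < √D := Real.sqrt_pos.mpr hD
    have hMs : M ≤ √D := Real.le_sqrt_of_sq_le hMD
    obtain ⟨j, hj⟩ := exists_div_le_norm_grushinSeries_sub hs0 (hpM.trans hMs)
      (hqM.trans hMs) hs.ge (Or.inl hs.le)
    have h3 := hj.trans (h2 j)
    rw [div_le_iff₀ (by positivity), ← hDdef] at h3
    have h4 : √D ≤ 8 * r := by nlinarith
    nlinarith
  · have hM0 : 0 < M := by nlinarith
    rcases le_total M (2 * r) with hMr | hMr
    · nlinarith
    · obtain ⟨j, hj⟩ := exists_div_le_norm_grushinSeries_sub hM0 hpM hqM hMD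
        (Or.inr (by
          rcases max_cases |p.1| |q.1| with h | h <;> constructor <;> linarith [h.1]))
      have h3 := hj.trans (h2 j)
      rw [div_le_iff₀ (by positivity), ← hDdef] at h3
      nlinarith

lemma PiecewiseC1On.enorm_sub_le_lintegral_deriv {f : ℝ → ℝ} {a b : ℝ}
    (hf : PiecewiseC1On f a b) {s : ℝ} (hs : s ∈ Icc a b) :
    ‖f s - f a‖ₑ ≤ ∫⁻ u in Icc a b, ‖deriv f u‖ₑ := by
  obtain ⟨-, n, t, rfl, rfl, hlt, hC⟩ := hf
  have hmono : ∀ i ≤ n, t 0 ≤ t i := by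
    intro i hi
    induction i with
    | zero => rfl
    | succ i ih => exact (ih (by omega)).trans (hlt i (by omega)).le
  have hloc : ∀ i < n, ∀ s ∈ Icc (t i) (t (i + 1)),
      ‖f s - f (t i)‖ₑ ≤ ∫⁻ u in Ioc (t i) s, ‖deriv f u‖ₑ := by
    intro i hi s hs
    rw [restrict_Ioc_eq_restrict_Icc]
    exact enorm_sub_le_lintegral_deriv_of_contDiffOn_Icc
      ((hC i hi).mono (Icc_subset_Icc_right hs.2)) hs.1
  have main : ∀ i ≤ n, ∀ s ∈ Icc (t 0) (t i),
      ‖f s - f (t 0)‖ₑ ≤ ∫⁻ u in Ioc (t 0) s, ‖deriv f u‖ₑ := by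
    intro i
    induction i with
    | zero =>
      intro _ s hs
      simp [le_antisymm hs.2 hs.1]
    | succ i ih =>
      intro hi s hs
      rcases le_total s (t i) with h | h
      · exact ih (by omega) s ⟨hs.1, h⟩
      · have h0 := hmono i (by omega)
        rw [← Ioc_union_Ioc_eq_Ioc h0 h,
          lintegral_union measurableSet_Ioc
            (Set.disjoint_left.mpr fun u hu hu' => hu.2.not_gt hu'.1), ← sub_add_sub_cancel']
        exact (enorm_add_le _ _).trans
          (add_le_add (ih (by omega) _ ⟨h0, le_rfl⟩) (hloc i (by omega) s ⟨h, hs.2⟩))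
  exact (main n le_rfl s hs).trans
    (lintegral_mono_set fun u hu => ⟨hu.1.le, hu.2.trans hs.2⟩)

lemma PiecewiseC1On.enorm_sub_le_grushinLength {x : ℝ → ℝ} (hx : PiecewiseC1On x 0 1)
    (y : ℝ → ℝ) {t : ℝ} (ht : t ∈ Icc (0 : ℝ) 1) : ‖x t - x 0‖ₑ ≤ grushinLength x y := by
  refine (hx.enorm_sub_le_lintegral_deriv ht).trans ?_
  rw [← restrict_Ioo_eq_restrict_Icc]
  refine lintegral_mono fun u => ?_
  rw [Real.enorm_eq_ofReal_abs]
  refine ENNReal.ofReal_le_ofReal (Real.abs_le_sqrt ?_)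
  have : 0 ≤ deriv y u ^ 2 / x u ^ 2 := by positivity
  linarith

lemma PiecewiseC1On.abs_sub_le_of_grushinLength_le {x y : ℝ → ℝ} (hx : PiecewiseC1On x 0 1)
    (hy : PiecewiseC1On y 0 1) (h0 : {t ∈ Icc (0 : ℝ) 1 | x t = 0}.Finite) {l : ℝ}
    (hl0 : 0 ≤ l) (hl : grushinLength x y ≤ ENNReal.ofReal l) :
    |x 1 - x 0| ≤ l ∧ |y 1 - y 0| ≤ (|x 0| + l) * l := by
  have hxl : ∀ t ∈ Icc (0 : ℝ) 1, |x t - x 0| ≤ l := fun t ht => by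
    have h := (hx.enorm_sub_le_grushinLength y ht).trans hl
    rwa [Real.enorm_eq_ofReal_abs, ENNReal.ofReal_le_ofReal_iff hl0] at h
  refine ⟨hxl 1 (by simp), ?_⟩
  have hc : 0 ≤ |x 0| + l := by positivity
  rw [← ENNReal.ofReal_le_ofReal_iff (by positivity), ← Real.enorm_eq_ofReal_abs,
    ENNReal.ofReal_mul hc]
  refine (hy.enorm_sub_le_lintegral_deriv (by simp)).trans (le_trans ?_ (mul_le_mul_right hl _))
  rw [← restrict_Ioo_eq_restrict_Icc, grushinLength,
    ← lintegral_const_mul' _ _ ENNReal.ofReal_ne_top]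
  refine lintegral_mono_ae ?_
  filter_upwards [self_mem_ae_restrict measurableSet_Ioo,
    ae_restrict_of_ae (h0.measure_zero volume |> compl_mem_ae_iff.mpr)] with t ht ht0
  have ht' := Ioo_subset_Icc_self ht
  have hxt : x t ≠ 0 := fun h => ht0 ⟨ht', h⟩
  rw [Real.enorm_eq_ofReal_abs, ← ENNReal.ofReal_mul hc]
  refine ENNReal.ofReal_le_ofReal ?_
  have hle : |x t| ≤ |x 0| + l := by
    linarith [hxl t ht', abs_sub_abs_le_abs_sub (x t) (x 0)]
  have hd : |deriv y t| / |x t| ≤ √(deriv x t ^ 2 + deriv y t ^ 2 / x t ^ 2) := by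
    rw [← abs_div]
    refine Real.abs_le_sqrt ?_
    rw [div_pow]
    linarith [sq_nonneg (deriv x t)]
  calc |deriv y t| = |x t| * (|deriv y t| / |x t|) := by
        rw [mul_div_cancel₀ _ (abs_ne_zero.mpr hxt)]
    _ ≤ _ := by gcongr

/-- Upper bound for the distance, realised by a quadratic `x` and by `y` with `y' = c x²`. -/
lemma grushinDist_le {C r : ℝ} (hr : 0 < r) {p q : ℝ × ℝ}
    (h1 : |q.1 - p.1| ≤ r) (h2 : |q.2 - p.2| ≤ C * (|p.1| + r) * r) :
    grushinDist p q ≤ ENNReal.ofReal ((120 * C + 2) * r) := by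
  obtain ⟨p1, p2⟩ := p
  obtain ⟨q1, q2⟩ := q
  simp only at h1 h2
  set d := q1 - p1 with hd
  obtain ⟨A, hA, hA2, hAx⟩ : ∃ A : ℝ, |A| = r ∧ A ^ 2 = r ^ 2 ∧ 0 ≤ A * (p1 + q1) := by
    rcases le_total 0 (p1 + q1) with h | h
    · exact ⟨r, abs_of_pos hr, rfl, by positivity⟩
    · exact ⟨-r, by rw [abs_neg, abs_of_pos hr], by ring, by nlinarith⟩
  have hA0 : A ≠ 0 := by
    rw [← abs_pos, hA]
    exact hr
  set x : ℝ → ℝ := fun t => p1 + t * d + A * (t * (1 - t)) with hxdef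
  set P : ℝ → ℝ := fun t => p1 ^ 2 * t + p1 * (d + A) * t ^ 2 +
    ((d + A) ^ 2 - 2 * p1 * A) / 3 * t ^ 3 - (d + A) * A / 2 * t ^ 4 + A ^ 2 / 5 * t ^ 5 with hP
  have hx' : ∀ t, HasDerivAt x (d + A * (1 - 2 * t)) t := fun t => by
    have := (((hasDerivAt_id t).mul_const d).const_add p1).add
      (((hasDerivAt_id t).mul ((hasDerivAt_id t).const_sub 1)).const_mul A)
    refine this.congr_deriv ?_
    simp only [id]
    ring
  have hP' : ∀ t, HasDerivAt P (x t ^ 2) t := fun t => by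
    have := (((((hasDerivAt_id t).const_mul (p1 ^ 2)).add
      ((hasDerivAt_pow 2 t).const_mul (p1 * (d + A)))).add
      ((hasDerivAt_pow 3 t).const_mul (((d + A) ^ 2 - 2 * p1 * A) / 3))).sub
      ((hasDerivAt_pow 4 t).const_mul ((d + A) * A / 2))).add
      ((hasDerivAt_pow 5 t).const_mul (A ^ 2 / 5))
    refine this.congr_deriv ?_
    simp only [hxdef]
    push_cast
    ring
  have hI : (|p1| + r) ^ 2 ≤ 60 * P 1 := by
    have : P 1 = (p1 ^ 2 + p1 * q1 + q1 ^ 2) / 3 + A * (p1 + q1) / 6 + A ^ 2 / 30 := by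
      simp only [hP, hd]
      ring
    rw [this, hA2]
    nlinarith [sq_nonneg (q1 + p1 / 2), sq_nonneg (|p1| - r), sq_abs p1]
  have hI0 : 0 < P 1 := by
    have : 0 < (|p1| + r) ^ 2 := by positivity
    linarith
  set c := (q2 - p2) / P 1
  have hy' : ∀ t, HasDerivAt (fun t => p2 + c * P t) (c * x t ^ 2) t := fun t =>
    ((hP' t).const_mul c).const_add p2
  have hcx : ∀ t ∈ Ioo (0 : ℝ) 1, |c * x t| ≤ 120 * C * r := by
    intro t ht
    have hxt : |x t| ≤ 2 * (|p1| + r) := by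
      have e1 : |t * d| ≤ r := by
        rw [abs_mul, abs_of_pos ht.1]
        nlinarith [ht.2, abs_nonneg d]
      have e2 : |A * (t * (1 - t))| ≤ r := by
        rw [abs_mul, hA, abs_of_pos (mul_pos ht.1 (sub_pos.mpr ht.2))]
        have : t * (1 - t) ≤ 1 := by nlinarith [ht.1, ht.2]
        nlinarith
      have := abs_add_three p1 (t * d) (A * (t * (1 - t)))
      simp only [hxdef]
      linarith [abs_nonneg p1]
    rw [abs_mul, abs_div, abs_of_pos hI0, div_mul_eq_mul_div, div_le_iff₀ hI0]
    have hC : 0 ≤ C := by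
      by_contra! hC
      have : 0 < (|p1| + r) * r := by positivity
      nlinarith [abs_nonneg (q2 - p2)]
    calc |q2 - p2| * |x t| ≤ C * (|p1| + r) * r * (2 * (|p1| + r)) := by gcongr
      _ = 2 * C * r * (|p1| + r) ^ 2 := by ring
      _ ≤ 2 * C * r * (60 * P 1) := by gcongr
      _ = _ := by ring
  have hpc : ∀ f : ℝ → ℝ, ContDiff ℝ 1 f → PiecewiseC1On f 0 1 := fun f hf =>
    ⟨hf.continuous.continuousOn, 1, fun i => i, by simp, by simp, by simp,
      fun i _ => hf.contDiffOn⟩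
  have hfin : {t ∈ Icc (0 : ℝ) 1 | x t = 0}.Finite := by
    have hpoly : (Polynomial.C (-A) * Polynomial.X ^ 2 + Polynomial.C (d + A) * Polynomial.X +
        Polynomial.C p1 : Polynomial ℝ) ≠ 0 := fun h => by
      have := congrArg (fun P => Polynomial.coeff P 2) h
      simp at this
      exact hA0 this
    refine (Polynomial.finite_setOfPred_isRoot hpoly).subset fun t ht => ?_
    have h0 : x t = 0 := ht.2
    simp only [hxdef] at h0
    simp only [mem_ofPred_eq, Polynomial.IsRoot.def, Polynomial.eval_add, Polynomial.eval_mul,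
      Polynomial.eval_C, Polynomial.eval_pow, Polynomial.eval_X]
    linarith
  have hle : grushinDist (p1, p2) (q1, q2) ≤ grushinLength x (fun t => p2 + c * P t) := by
    refine iInf_le_of_le x (iInf_le_of_le _ (iInf_le_of_le (hpc _ (by fun_prop))
      (iInf_le_of_le (hpc _ (by fun_prop)) (iInf_le_of_le hfin (iInf_le_of_le ?_ le_rfl)))))
    refine ⟨by simp [hxdef], by simp [hP], by simp [hxdef, hd], ?_⟩
    simp only [c, div_mul_cancel₀ _ hI0.ne', add_sub_cancel]
  refine hle.trans ?_
  rw [grushinLength]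
  calc _ ≤ ∫⁻ _ in Ioo (0 : ℝ) 1, ENNReal.ofReal ((120 * C + 2) * r) := by
        refine setLIntegral_mono measurable_const fun t ht => ENNReal.ofReal_le_ofReal ?_
        rw [(hx' t).deriv, (hy' t).deriv]
        have e1 : |d + A * (1 - 2 * t)| ≤ 2 * r := by
          refine (abs_add_le _ _).trans ?_
          have : |1 - 2 * t| ≤ 1 := abs_le.mpr ⟨by linarith [ht.2], by linarith [ht.1]⟩
          rw [abs_mul, hA]
          nlinarith
        have e2 := hcx t ht
        have e3 : (c * x t ^ 2) ^ 2 / x t ^ 2 = (c * x t) ^ 2 := by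
          rcases eq_or_ne (x t) 0 with h | h
          · simp [h]
          · field_simp
        rw [e3]
        refine Real.sqrt_le_iff.mpr ⟨by linarith [abs_nonneg (c * x t)], ?_⟩
        rw [← sq_abs, ← sq_abs (c * x t)]
        nlinarith [abs_nonneg (c * x t), abs_nonneg (d + A * (1 - 2 * t))]
    _ = _ := by simp

/-- The embedding, with values in a product of finite-dimensional spaces. -/
noncomputable def grushinEmbedding (p : ℝ × ℝ) : ℝ × (Fin 10 → ℂ) :=
  (p.1, fun j => grushinSeries j p)

lemma norm_grushinEmbedding_sub_le {l : ℝ} (hl : 0 ≤ l) {p q : ℝ × ℝ}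
    (h1 : |q.1 - p.1| ≤ l) (h2 : |q.2 - p.2| ≤ (|p.1| + l) * l) :
    ‖grushinEmbedding q - grushinEmbedding p‖ ≤ 120 * l := by
  rcases hl.eq_or_lt with rfl | hl
  · have e1 : q.1 = p.1 := sub_eq_zero.mp (abs_nonpos_iff.mp h1)
    have e2 : q.2 = p.2 := sub_eq_zero.mp (abs_nonpos_iff.mp (by simpa using h2))
    simp [Prod.ext e1 e2]
  · refine (Prod.norm_def _).trans_le (max_le ?_ ?_)
    · exact h1.trans (by linarith)
    · exact (pi_norm_le_iff_of_nonneg (by positivity)).mpr fun j =>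
        norm_grushinSeries_sub_le j hl h1 h2

lemma ofReal_norm_grushinEmbedding_sub_le (p q : ℝ × ℝ) :
    ENNReal.ofReal ‖grushinEmbedding q - grushinEmbedding p‖ ≤
      ENNReal.ofReal 120 * grushinDist p q := by
  rw [mul_comm, ← ENNReal.div_le_iff (by simp) (by simp)]
  unfold grushinDist
  refine le_iInf fun x => le_iInf fun y => le_iInf fun hx => le_iInf fun hy =>
    le_iInf fun h0 => le_iInf fun ⟨hp1, hp2, hq1, hq2⟩ => ?_
  rw [ENNReal.div_le_iff (by simp) (by simp)]
  rcases eq_or_ne (grushinLength x y) ⊤ with htop | htop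
  · rw [htop, ENNReal.top_mul (by simp)]
    exact le_top
  · obtain ⟨h1, h2⟩ := hx.abs_sub_le_of_grushinLength_le hy h0 ENNReal.toReal_nonneg
      (ENNReal.ofReal_toReal htop).ge
    rw [hp1, hq1] at h1
    rw [hp1, hp2, hq2] at h2
    rw [← ENNReal.ofReal_toReal htop, ← ENNReal.ofReal_mul ENNReal.toReal_nonneg, mul_comm]
    exact ENNReal.ofReal_le_ofReal (norm_grushinEmbedding_sub_le ENNReal.toReal_nonneg h1 h2)

lemma grushinDist_le_norm_grushinEmbedding_sub (p q : ℝ × ℝ) :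
    grushinDist p q ≤
      ENNReal.ofReal (7682 * ‖grushinEmbedding q - grushinEmbedding p‖) := by
  set r := ‖grushinEmbedding q - grushinEmbedding p‖ with hr
  have hr0 : 0 ≤ r := norm_nonneg _
  have h1 : |q.1 - p.1| ≤ r := norm_fst_le (grushinEmbedding q - grushinEmbedding p)
  have h2 : ∀ j, ‖grushinSeries j q - grushinSeries j p‖ ≤ r := fun j =>
    (norm_le_pi_norm (grushinEmbedding q - grushinEmbedding p).2 j).trans (norm_snd_le _)
  have h3 := abs_snd_sub_le_of_grushinSeries h1 h2
  refine ENNReal.le_of_forall_pos_le_add fun ε hε _ => ?_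
  have hε' : (0 : ℝ) < ε / 7682 := by positivity
  have h4 := grushinDist_le (C := 64) (r := r + ε / 7682) (by positivity)
    (h1.trans (by linarith)) (h3.trans (by gcongr <;> linarith))
  refine h4.trans ?_
  rw [← ENNReal.ofReal_coe_nnreal, ← ENNReal.ofReal_add (by positivity) (by positivity)]
  refine ENNReal.ofReal_le_ofReal (le_of_eq ?_)
  ring

/-- The Grushin plane, equipped with the Carnot–Carathéodory distance,
admits a bi-Lipschitz embedding into some Euclidean space. -/
theorem statement17 :
    ∃ (N : ℕ) (L : ℝ) (F : ℝ × ℝ → EuclideanSpace ℝ (Fin N)), 1 ≤ L ∧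
      ∀ p q : ℝ × ℝ,
        ENNReal.ofReal L⁻¹ * grushinDist p q ≤
            ENNReal.ofReal (dist (F p) (F q)) ∧
          ENNReal.ofReal (dist (F p) (F q)) ≤
            ENNReal.ofReal L * grushinDist p q := by
  let e := toEuclidean (E := ℝ × (Fin 10 → ℂ))
  obtain ⟨K, hK0, hK⟩ := e.toContinuousLinearMap.bound
  obtain ⟨K', hK'0, hK'⟩ := e.symm.toContinuousLinearMap.bound
  refine ⟨_, max 1 (max (120 * K) (7682 * K')), fun p => e (grushinEmbedding p),
    le_max_left _ _, fun p q => ?_⟩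
  set L := max 1 (max (120 * K) (7682 * K'))
  have hL0 : 0 < L := zero_lt_one.trans_le (le_max_left _ _)
  have hLK : 120 * K ≤ L := (le_max_left _ _).trans (le_max_right _ _)
  have hLK' : 7682 * K' ≤ L := (le_max_right _ _).trans (le_max_right _ _)
  set v := grushinEmbedding q - grushinEmbedding p
  have hd : dist (e (grushinEmbedding p)) (e (grushinEmbedding q)) = ‖e v‖ := by
    rw [dist_comm, dist_eq_norm, map_sub]
  rw [hd]
  have hv : ‖e v‖ ≤ K * ‖v‖ := hK v
  have hv' : ‖v‖ ≤ K' * ‖e v‖ := by simpa using hK' (e v)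
  constructor
  · calc ENNReal.ofReal L⁻¹ * grushinDist p q
        ≤ ENNReal.ofReal L⁻¹ * ENNReal.ofReal (7682 * ‖v‖) := by
          gcongr
          exact grushinDist_le_norm_grushinEmbedding_sub p q
      _ = ENNReal.ofReal (L⁻¹ * (7682 * ‖v‖)) := (ENNReal.ofReal_mul (by positivity)).symm
      _ ≤ ENNReal.ofReal ‖e v‖ := by
          refine ENNReal.ofReal_le_ofReal ?_
          rw [inv_mul_le_iff₀ hL0]
          nlinarith [norm_nonneg (e v)]
  · calc ENNReal.ofReal ‖e v‖ ≤ ENNReal.ofReal (K * ‖v‖) := ENNReal.ofReal_le_ofReal hv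
      _ = ENNReal.ofReal K * ENNReal.ofReal ‖v‖ := ENNReal.ofReal_mul hK0.le
      _ ≤ ENNReal.ofReal K * (ENNReal.ofReal 120 * grushinDist p q) := by
          gcongr
          exact ofReal_norm_grushinEmbedding_sub_le p q
      _ = ENNReal.ofReal (120 * K) * grushinDist p q := by
          rw [← mul_assoc, mul_comm (ENNReal.ofReal K), ← ENNReal.ofReal_mul (by norm_num)]
      _ ≤ _ := by gcongr
end
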